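/- arXiv:2512.16398 — 2 statements merged into one kernel-verified Lean document; each statement's English description precedes it below -/
import Mathlib

section
/- Let 2 ≤ r < s ≤ 3r+1 be integers, write s = pr + q with 0 ≤ q < r, and let k > r. Let t be the largest integer ℓ ≥ r+1 satisfying (ℓ/(ℓ−r))·(1 − 1/ℓ)^s > 1 if such an ℓ exists, and t = r otherwise. Set ℓ = min{k−1, t}. Then the inducibility of the Turán graph T(s,r) over K_k-free graphs is i_k(T(s,r)) = ℓ!·s! / ((ℓ−r)!·(r−q)!·q!·(p!)^r·(p+1)^q·ℓ^s). -/
open Filter Topology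

/-- The number of `|V(F)|`-element subsets of the vertex set of `G` that induce a
subgraph isomorphic to `F`. -/
noncomputable def inducedCount {α β : Type*} [Fintype α] [Fintype β]
    (F : SimpleGraph α) (G : SimpleGraph β) : ℕ :=
  Set.ncard {s : Finset β | s.card = Fintype.card α ∧
    Nonempty (F ≃g SimpleGraph.induce (↑s : Set β) G)}

/-- The induced density `p(F,G) = P(F,G)/C(n,r)`. -/
noncomputable def inducedDensity {α β : Type*} [Fintype α] [Fintype β]
    (F : SimpleGraph α) (G : SimpleGraph β) : ℝ :=
  (inducedCount F G : ℝ) / ((Fintype.card β).choose (Fintype.card α))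

/-- `i_k(F,n)`: the maximum induced density of `F` over `K_k`-free graphs on `n` vertices. -/
noncomputable def ikn {α : Type*} [Fintype α] (F : SimpleGraph α) (k n : ℕ) : ℝ :=
  sSup {x : ℝ | ∃ G : SimpleGraph (Fin n), G.CliqueFree k ∧ x = inducedDensity F G}

/-- `i_k(F) = lim_{n → ∞} i_k(F,n)`. -/
noncomputable def ik {α : Type*} [Fintype α] (F : SimpleGraph α) (k : ℕ) : ℝ :=
  limUnder atTop (fun n => ikn F k n)

/-- A graph `F` is inducibility diverse if for every `k` there is `m > k`
with `i_k(F) < i_m(F)`. -/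
def InducibilityDiverse {α : Type*} [Fintype α] (F : SimpleGraph α) : Prop :=
  ∀ k : ℕ, ∃ m : ℕ, k < m ∧ ik F k < ik F m

/-- The ratio function `f(ℓ) = (ℓ/(ℓ-r))·(1 - 1/ℓ)^s`. -/
noncomputable def turanRatio (r s ℓ : ℕ) : ℝ :=
  ((ℓ : ℝ) / ((ℓ : ℝ) - (r : ℝ))) * (1 - 1 / (ℓ : ℝ)) ^ s

/-- `g(ℓ) = ℓ!·s!/((ℓ-r)!·(r-q)!·q!·(p!)^r·(p+1)^q·ℓ^s)`, where `s = pr + q`. -/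
noncomputable def gTuran (r s p q ℓ : ℕ) : ℝ :=
  ((ℓ.factorial * s.factorial : ℕ) : ℝ) /
    (((ℓ - r).factorial * (r - q).factorial * q.factorial *
        p.factorial ^ r * (p + 1) ^ q : ℕ) * (ℓ : ℝ) ^ s)

/-- A vertex map that preserves and reflects adjacency. -/
def IsStrongHom {α V : Type*} (F : SimpleGraph α) (G : SimpleGraph V) (φ : α → V) : Prop :=
  ∀ a b, F.Adj a b ↔ G.Adj (φ a) (φ b)

open Classical in
/-- The total weight of the strong homomorphisms `F → G` for the vertex weights `x`. -/
noncomputable def strongHomWeight {α V : Type*} [Fintype α] [Fintype V]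
    (F : SimpleGraph α) (G : SimpleGraph V) (x : V → ℝ) : ℝ :=
  ∑ φ : α → V, (∏ a, x (φ a)) * if IsStrongHom F G φ then 1 else 0

section Weights

open Classical

variable {α V W : Type*}

/-- In a complete multipartite source, vertices with nonadjacent images can be folded together. -/
theorem IsStrongHom.fold {F : SimpleGraph α} {G : SimpleGraph V} {φ : α → V}
    (hF : ∀ a b c, ¬ F.Adj a b → ¬ F.Adj b c → ¬ F.Adj a c)
    (hφ : IsStrongHom F G φ) {u v : V} (huv : ¬ G.Adj u v) {a₀ : α} (h₀ : φ a₀ = u) :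
    IsStrongHom F G (fun a => if φ a = v then u else φ a) := by
  have twin : ∀ a b, φ a = v → (F.Adj a b ↔ F.Adj a₀ b) := by
    intro a b ha
    have h1 : ¬ F.Adj a₀ a := by rw [hφ, h₀, ha]; exact huv
    have h2 : ¬ F.Adj a a₀ := fun h => h1 h.symm
    constructor
    · intro h
      by_contra h3
      exact hF _ _ _ h2 h3 h
    · intro h
      by_contra h3
      exact hF _ _ _ h1 h3 h
  intro a b
  by_cases ha : φ a = v <;> by_cases hb : φ b = v
  · simp only [ha, hb, if_true, SimpleGraph.irrefl, iff_false]
    rw [hφ, ha, hb]; exact G.irrefl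
  · simp only [ha, hb, if_true, if_false]
    rw [twin a b ha, hφ, h₀]
  · simp only [ha, hb, if_true, if_false]
    rw [F.adj_comm, twin b a hb, F.adj_comm, hφ, h₀]
  · simp only [ha, hb, if_false]
    exact hφ a b

variable [Fintype α] [Fintype V] [Fintype W]

theorem sum_prod_pushforward (m : W → V) (q : W → ℝ) (h : (α → V) → ℝ) :
    ∑ φ : α → V, (∏ a, ∑ w with m w = φ a, q w) * h φ =
      ∑ P : α → W, (∏ a, q (P a)) * h (m ∘ P) := by
  rw [← Finset.sum_fiberwise Finset.univ (fun P : α → W => m ∘ P)]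
  refine Finset.sum_congr rfl fun φ _ => ?_
  rw [Finset.prod_univ_sum, Finset.sum_mul]
  refine Finset.sum_congr ?_ fun P hP => ?_
  · ext P
    simp [Fintype.mem_piFinset, funext_iff]
  · rw [show m ∘ P = φ by simpa [Fintype.mem_piFinset, funext_iff] using hP]

theorem strongHomWeight_pushforward (F : SimpleGraph α) (G : SimpleGraph V) (m : W → V)
    (q : W → ℝ) (x : V → ℝ) (hx : ∀ v, x v = ∑ w with m w = v, q w) :
    strongHomWeight F G x =
      ∑ P : α → W, (∏ a, q (P a)) * if IsStrongHom F G (m ∘ P) then 1 else 0 := by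
  rw [← sum_prod_pushforward m q (fun φ => if IsStrongHom F G φ then 1 else 0)]
  simp only [strongHomWeight, hx]

theorem strongHomWeight_comap (F : SimpleGraph α) (G : SimpleGraph V) (m : W → V)
    (q : W → ℝ) (x : V → ℝ) (hx : ∀ v, x v = ∑ w with m w = v, q w) :
    strongHomWeight F G x = strongHomWeight F (G.comap m) q := by
  rw [strongHomWeight_pushforward F G m q x hx]
  rfl

theorem strongHomWeight_induce (F : SimpleGraph α) (G : SimpleGraph V) (x : V → ℝ)
    (K : Finset V) (hK : ∀ v, v ∉ K → x v = 0) :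
    strongHomWeight F G x =
      strongHomWeight F (G.induce (K : Set V)) (fun v : (K : Set V) => x v) := by
  refine strongHomWeight_comap F G (fun v : (K : Set V) => (v : V)) _ x fun v => ?_
  by_cases hv : v ∈ K
  · rw [Finset.sum_eq_single ⟨v, hv⟩]
    · rintro ⟨b, hb⟩ h1 h2
      simp at h1 h2
      exact absurd h1 h2
    · simp
  · rw [hK v hv, Finset.sum_eq_zero]
    rintro ⟨b, hb⟩ h1
    simp at h1
    subst h1
    exact absurd hb hv

theorem sum_prod_mul_ite (w : Bool → ℝ) (hw : w false + w true = 1) (a₀ : α) (e : Bool) :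
    ∑ ε : α → Bool, (∏ a, w (ε a)) * (if ε a₀ = e then 1 else 0) = w e := by
  have h : ∀ ε : α → Bool, (∏ a, w (ε a)) * (if ε a₀ = e then (1 : ℝ) else 0) =
      ∏ a, w (ε a) * (if a = a₀ then (if ε a = e then 1 else 0) else 1) := by
    intro ε
    rw [Finset.prod_mul_distrib, Finset.prod_ite_eq' Finset.univ a₀]
    simp
  simp_rw [h]
  have := Finset.prod_univ_sum (fun _ : α => (Finset.univ : Finset Bool))
    (fun a b => w b * (if a = a₀ then (if b = e then (1 : ℝ) else 0) else 1))
  simp only [Fintype.piFinset_univ] at this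
  rw [← this, Finset.prod_eq_single a₀]
  · cases e <;> simp
  · intro b _ hb
    simp [hb, add_comm, hw]
  · simp

theorem sum_prod_bool (w : Bool → ℝ) (hw : w false + w true = 1) :
    ∑ ε : α → Bool, (∏ a, w (ε a)) = 1 := by
  have := Finset.prod_univ_sum (fun _ : α => (Finset.univ : Finset Bool)) (fun _ b => w b)
  simp only [Fintype.piFinset_univ] at this
  rw [← this]
  simp [add_comm, hw]

/-- Shifting weight between two nonadjacent vertices: the weight is dominated by the
convex combination of the two extreme positions. -/
theorem strongHomWeight_le_of_not_adj {F : SimpleGraph α} {G : SimpleGraph V}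
    (hF : ∀ a b c, ¬ F.Adj a b → ¬ F.Adj b c → ¬ F.Adj a c)
    {x : V → ℝ} (hx : ∀ v, 0 ≤ x v) {u v : V} (huv : ¬ G.Adj u v) (hne : u ≠ v)
    (hc : 0 < x u + x v) :
    strongHomWeight F G x ≤
      x u / (x u + x v) *
        strongHomWeight F G (Function.update (Function.update x u (x u + x v)) v 0) +
      x v / (x u + x v) *
        strongHomWeight F G (Function.update (Function.update x v (x u + x v)) u 0) := by
  set c := x u + x v with hcdef
  set y := Function.update (Function.update x u c) v 0 with hy
  set w : Bool → ℝ := fun e => if e then x v / c else x u / c with hw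
  have hw1 : w false + w true = 1 := by
    simp only [hw]
    simp
    rw [← add_div, ← hcdef, div_self hc.ne']
  have hw0 : ∀ e, 0 ≤ w e := by
    intro e
    simp only [hw]
    split_ifs
    · exact div_nonneg (hx _) hc.le
    · exact div_nonneg (hx _) hc.le
  have hyu : y u = c := by simp [hy, hne]
  have hyv : y v = 0 := by simp [hy]
  have hyo : ∀ z, z ≠ u → z ≠ v → y z = x z := by
    intro z h1 h2; simp [hy, h1, h2]
  have hy0 : ∀ z, 0 ≤ y z := by
    intro z
    by_cases h1 : z = u
    · rw [h1, hyu]; exact hc.le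
    · by_cases h2 : z = v
      · rw [h2, hyv]
      · rw [hyo z h1 h2]; exact hx z
  let m : V × Bool → V := fun z => if z.1 = u ∧ z.2 = true then v else z.1
  let m₁ : V → V := fun z => if z = u then v else z
  have e1 : strongHomWeight F G x = ∑ P : α → V × Bool,
      (∏ a, (y (P a).1 * w (P a).2)) * if IsStrongHom F G (m ∘ P) then 1 else 0 := by
    refine strongHomWeight_pushforward F G m (fun z => y z.1 * w z.2) x fun z => ?_
    rw [Finset.sum_filter, Fintype.sum_prod_type]
    simp only [Fintype.sum_bool, m]
    by_cases h1 : z = u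
    · subst h1
      rw [Finset.sum_eq_single z]
      · simp [hne.symm, hyu, hw]
        field_simp
      · intro b _ hb
        simp [hb]
      · simp
    · by_cases h2 : z = v
      · subst h2
        rw [Finset.sum_eq_single u]
        · simp [hne, hyu, hw]
          field_simp
        · intro b _ hb
          by_cases hb2 : b = z
          · simp [hb2, hyv]
          · simp [hb, hb2]
        · simp
      · rw [Finset.sum_eq_single z]
        · simp [h1, hyo z h1 h2, ← mul_add, add_comm (w true), hw1]
        · intro b _ hb
          by_cases hb2 : b = u
          · subst hb2
            simp [hb, Ne.symm h2]
          · simp [hb, hb2]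
        · simp
  have e2 : strongHomWeight F G (Function.update (Function.update x v c) u 0) =
      ∑ ψ : α → V, (∏ a, y (ψ a)) * if IsStrongHom F G (m₁ ∘ ψ) then 1 else 0 := by
    refine strongHomWeight_pushforward F G m₁ y _ fun z => ?_
    rw [Finset.sum_filter]
    simp only [m₁]
    by_cases h1 : z = u
    · subst h1
      rw [Finset.sum_eq_zero]
      · simp
      · intro b _
        by_cases hb : b = z
        · simp [hb, hne.symm]
        · simp [hb]
    · by_cases h2 : z = v
      · subst h2
        rw [Finset.sum_eq_single u]
        · simp [hne.symm, hyu]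
        · intro b _ hb
          by_cases hb2 : b = z
          · simp [hb2, hyv]
          · simp [hb, hb2]
        · simp
      · rw [Finset.sum_eq_single z]
        · simp [h1, h2, hyo z h1 h2]
        · intro b _ hb
          by_cases hb2 : b = u
          · subst hb2
            simp [Ne.symm h2]
          · simp [hb, hb2]
        · simp
  rw [e1, e2, ← (Equiv.arrowProdEquivProdArrow α (fun _ => V) (fun _ => Bool)).symm.sum_comp,
    Fintype.sum_prod_type]
  rw [strongHomWeight, Finset.mul_sum, Finset.mul_sum, ← Finset.sum_add_distrib]
  refine Finset.sum_le_sum fun ψ _ => ?_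
  have hyψ : 0 ≤ ∏ a, y (ψ a) := Finset.prod_nonneg fun a _ => hy0 _
  have key : ∑ ε : α → Bool, (∏ a, w (ε a)) *
      (if IsStrongHom F G (fun a => m (ψ a, ε a)) then (1 : ℝ) else 0) ≤
        w false * (if IsStrongHom F G ψ then 1 else 0) +
        w true * (if IsStrongHom F G (m₁ ∘ ψ) then 1 else 0) ∨ ∃ a, ψ a = v := by
    by_cases hv : ∃ a, ψ a = v
    · exact Or.inr hv
    left
    push Not at hv
    by_cases hu : ∃ a, ψ a = u
    · obtain ⟨a₀, ha₀⟩ := hu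
      calc _ ≤ ∑ ε : α → Bool, (∏ a, w (ε a)) *
            ((if ε a₀ = false then 1 else 0) * (if IsStrongHom F G ψ then 1 else 0) +
             (if ε a₀ = true then 1 else 0) * (if IsStrongHom F G (m₁ ∘ ψ) then 1 else 0)) := by
            refine Finset.sum_le_sum fun ε _ => ?_
            refine mul_le_mul_of_nonneg_left ?_ (Finset.prod_nonneg fun a _ => hw0 _)
            by_cases hs : IsStrongHom F G (fun a => m (ψ a, ε a))
            · rw [if_pos hs]
              cases he : ε a₀
              · have h := hs.fold hF huv (a₀ := a₀) (by simp [m, ha₀, he])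
                have h' : (fun a => if m (ψ a, ε a) = v then u else m (ψ a, ε a)) = ψ := by
                  funext a
                  simp only [m]
                  by_cases h1 : ψ a = u
                  · by_cases h2 : ε a = true <;> simp [h1, h2, hne]
                  · simp [h1, hv a]
                rw [h'] at h
                simp [h]
              · have h := hs.fold hF (fun h => huv h.symm) (a₀ := a₀) (u := v) (v := u)
                  (by simp [m, ha₀, he])
                have h' : (fun a => if m (ψ a, ε a) = u then v else m (ψ a, ε a)) = m₁ ∘ ψ := by
                  funext a
                  simp only [m, m₁, Function.comp]
                  by_cases h1 : ψ a = u
                  · by_cases h2 : ε a = true <;> simp [h1, h2, hne.symm]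
                  · simp [h1]
                rw [h'] at h
                simp [h]
            · rw [if_neg hs]
              positivity
        _ = _ := by
            simp_rw [mul_add, ← mul_assoc]
            rw [Finset.sum_add_distrib, ← Finset.sum_mul, ← Finset.sum_mul,
              sum_prod_mul_ite w hw1, sum_prod_mul_ite w hw1]
    · push Not at hu
      have h1 : ∀ ε : α → Bool, (fun a => m (ψ a, ε a)) = ψ := by
        intro ε; funext a; simp [m, hu a]
      have h2 : m₁ ∘ ψ = ψ := by
        funext a; simp [m₁, hu a]
      simp_rw [h1, h2]
      rw [← Finset.sum_mul, sum_prod_bool w hw1, ← add_mul, hw1]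
  rcases key with key | ⟨a, ha⟩
  · have := mul_le_mul_of_nonneg_left key hyψ
    rw [Finset.mul_sum] at this
    refine le_trans (le_of_eq ?_) (this.trans (le_of_eq ?_))
    · refine Finset.sum_congr rfl fun ε _ => ?_
      simp only [Finset.prod_mul_distrib, mul_assoc]
      rfl
    · rw [show w false = x u / c by simp [hw], show w true = x v / c by simp [hw]]
      ring
  · have h0 : ∏ a, y (ψ a) = 0 := Finset.prod_eq_zero (Finset.mem_univ a) (by rw [ha, hyv])
    rw [h0]
    simp only [zero_mul, mul_zero, add_zero]
    refine (Finset.sum_eq_zero fun ε _ => ?_).le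
    have : ∏ a, (y (ψ a) * w (ε a)) = 0 :=
      Finset.prod_eq_zero (Finset.mem_univ a) (by rw [ha, hyv, zero_mul])
    exact mul_eq_zero_of_left this _

/-- A bound for weights supported on cliques extends to all weights. -/
theorem strongHomWeight_le_of_clique {F : SimpleGraph α} {G : SimpleGraph V}
    (hF : ∀ a b c, ¬ F.Adj a b → ¬ F.Adj b c → ¬ F.Adj a c) {M : ℝ}
    (hM : ∀ x ∈ stdSimplex ℝ V, G.IsClique {v | x v ≠ 0} → strongHomWeight F G x ≤ M)
    {x : V → ℝ} (hx : x ∈ stdSimplex ℝ V) : strongHomWeight F G x ≤ M := by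
  induction hN : (Finset.univ.filter fun v => x v ≠ 0).card using Nat.strong_induction_on
    generalizing x with
  | _ N ih =>
  by_cases hcl : G.IsClique {v | x v ≠ 0}
  · exact hM x hx hcl
  rw [SimpleGraph.IsClique, Set.Pairwise] at hcl
  push Not at hcl
  obtain ⟨u, hu, v, hv, hne, huv⟩ := hcl
  have hu' : 0 < x u := lt_of_le_of_ne (hx.1 u) (Ne.symm hu)
  have hv' : 0 < x v := lt_of_le_of_ne (hx.1 v) (Ne.symm hv)
  have shift : ∀ u v, u ≠ v → 0 < x u → 0 < x v →
      strongHomWeight F G (Function.update (Function.update x u (x u + x v)) v 0) ≤ M := by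
    intro u v hne hu hv
    set y := Function.update (Function.update x u (x u + x v)) v 0 with hy
    refine ih _ ?_ (x := y) ⟨fun z => ?_, ?_⟩ rfl
    · rw [← hN]
      refine Finset.card_lt_card (Finset.ssubset_iff_of_subset ?_ |>.2 ⟨v, ?_, ?_⟩)
      · intro z
        simp only [Finset.mem_filter, Finset.mem_univ, true_and, hy]
        by_cases h1 : z = v
        · simp [h1]
        · by_cases h2 : z = u
          · subst h2; intro _; exact hu.ne'
          · simp [h1, h2]
      · simp [hv.ne']
      · simp [hy]
    · by_cases h1 : z = v
      · simp [hy, h1]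
      · by_cases h2 : z = u
        · subst h2; simp [hy, h1]; linarith
        · simp [hy, h1, h2]; exact hx.1 z
    · have h2 := hx.2
      rw [← Finset.add_sum_erase _ _ (Finset.mem_univ u),
        ← Finset.add_sum_erase _ _ (show v ∈ Finset.univ.erase u by simp [hne.symm])] at h2 ⊢
      rw [← h2]
      have : ∑ z ∈ (Finset.univ.erase u).erase v, y z =
          ∑ z ∈ (Finset.univ.erase u).erase v, x z := by
        refine Finset.sum_congr rfl fun z hz => ?_
        simp only [Finset.mem_erase] at hz
        simp [hy, hz.1, hz.2.1]
      rw [this]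
      simp [hy, hne]
      ring
  have h1 := shift u v hne hu' hv'
  have h2 := shift v u hne.symm hv' hu'
  rw [add_comm (x v)] at h2
  have hc : 0 < x u + x v := by linarith
  calc _ ≤ _ := strongHomWeight_le_of_not_adj hF hx.1 huv hne hc
    _ ≤ x u / (x u + x v) * M + x v / (x u + x v) * M := by gcongr
    _ = M := by field_simp

end Weights

/-- The two-variable inequality comparing a pair of weights with its merged and averaged pairs. -/
theorem pair_inequality {x y : ℝ} (hx : 0 < x) (hy : 0 < y) {p i j : ℕ} (hp : 1 ≤ p) (hp3 : p ≤ 3)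
    (hi : i = 0 ∨ i = p ∨ i = p + 1) (hj : j = 0 ∨ j = p ∨ j = p + 1) :
    x ^ i * y ^ j + y ^ i * x ^ j ≤
      (1 - 4 * x * y / (x + y) ^ 2) * ((x + y) ^ i * 0 ^ j + 0 ^ i * (x + y) ^ j) +
        4 * x * y / (x + y) ^ 2 * (2 * (((x + y) / 2) ^ i * ((x + y) / 2) ^ j)) := by
  set μ := 4 * x * y / (x + y) ^ 2 with hμ
  set h := (x + y) / 2 with hh
  have hc : x + y = 2 * h := by rw [hh]; ring
  have hh0 : 0 < h := by positivity
  have hz : x * y = μ * h ^ 2 := by rw [hμ, hh]; field_simp; norm_num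
  have hμ0 : 0 ≤ μ := by positivity
  have hμ1 : μ ≤ 1 := by
    rw [hμ, div_le_one (by positivity)]
    nlinarith [sq_nonneg (x - y)]
  rw [hc]
  clear_value μ
  clear hμ hh
  have single : ∀ a : ℕ, 1 ≤ a → a ≤ 4 →
      x ^ a + y ^ a ≤ (1 - μ) * (2 * h) ^ a + μ * (2 * h ^ a) := by
    intro a h1 h2
    have hy' : y = 2 * h - x := by linarith
    have hxx : x ^ 2 = 2 * h * x - μ * h ^ 2 := by
      rw [← hz, hy']; ring
    have hyy : y ^ 2 = 2 * h * y - μ * h ^ 2 := by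
      rw [← hz, hy']; ring
    have e2 : x ^ 2 + y ^ 2 = (4 - 2 * μ) * h ^ 2 := by rw [hxx, hyy, hy']; ring
    have e3 : x ^ 3 + y ^ 3 = (8 - 6 * μ) * h ^ 3 := by
      have : x ^ 3 + y ^ 3 = 2 * h * (x ^ 2 + y ^ 2) - μ * h ^ 2 * (x + y) := by
        rw [← hz, ← hc]; ring
      rw [this, e2, hc]; ring
    have e4 : x ^ 4 + y ^ 4 = (16 - 16 * μ + 2 * μ ^ 2) * h ^ 4 := by
      have : x ^ 4 + y ^ 4 = (x ^ 2 + y ^ 2) ^ 2 - 2 * (x * y) ^ 2 := by ring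
      rw [this, e2, hz]; ring
    interval_cases a
    · linarith
    · rw [e2]; apply le_of_eq; ring
    · rw [e3]; apply le_of_eq; ring
    · rw [e4]
      have : 0 ≤ μ * (1 - μ) * h ^ 4 := mul_nonneg (mul_nonneg hμ0 (by linarith)) (by positivity)
      linarith
  have double : ∀ a : ℕ, 1 ≤ a → (x * y) ^ a ≤ μ * (h ^ 2) ^ a := by
    intro a ha
    rw [hz, mul_pow]
    have : μ ^ a ≤ μ := pow_le_of_le_one hμ0 hμ1 (by omega)
    gcongr
  have mixed : x ^ p * y ^ (p + 1) + y ^ p * x ^ (p + 1) ≤ μ * (2 * (h ^ p * h ^ (p + 1))) := by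
    have h1 := double p hp
    calc _ = (x * y) ^ p * (x + y) := by rw [mul_pow]; ring
      _ ≤ (μ * (h ^ 2) ^ p) * (x + y) := by gcongr
      _ = _ := by rw [hc, ← pow_mul, pow_succ, two_mul p, pow_add]; ring
  have hp0 : p ≠ 0 := by omega
  rcases hi with hi | hi | hi <;> rcases hj with hj | hj | hj <;> rw [hi, hj]
  · simp; linarith
  · have := single p hp (by omega)
    simp only [pow_zero, zero_pow hp0]; linarith
  · have := single (p + 1) (by omega) (by omega)
    simp only [pow_zero, zero_pow (Nat.succ_ne_zero p)]; linarith
  · have := single p hp (by omega)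
    simp only [pow_zero, zero_pow hp0]; linarith
  · have := double p hp
    simp only [zero_pow hp0]
    have e1 : x ^ p * y ^ p = (x * y) ^ p := by rw [mul_pow]
    have e2 : y ^ p * x ^ p = (x * y) ^ p := by rw [mul_pow, mul_comm]
    have e3 : h ^ p * h ^ p = (h ^ 2) ^ p := by rw [← mul_pow, sq]
    rw [e1, e2, e3]; linarith
  · simp only [zero_pow hp0, zero_pow (Nat.succ_ne_zero p)]
    linarith
  · have := single (p + 1) (by omega) (by omega)
    simp only [pow_zero, zero_pow (Nat.succ_ne_zero p)]; linarith
  · simp only [zero_pow hp0, zero_pow (Nat.succ_ne_zero p)]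
    have e : h ^ (p + 1) * h ^ p = h ^ p * h ^ (p + 1) := mul_comm _ _
    rw [e]
    linarith
  · have := double (p + 1) (by omega)
    simp only [zero_pow (Nat.succ_ne_zero p)]
    have e1 : x ^ (p + 1) * y ^ (p + 1) = (x * y) ^ (p + 1) := by rw [mul_pow]
    have e2 : y ^ (p + 1) * x ^ (p + 1) = (x * y) ^ (p + 1) := by rw [mul_pow, mul_comm]
    have e3 : h ^ (p + 1) * h ^ (p + 1) = (h ^ 2) ^ (p + 1) := by rw [← mul_pow, sq]
    rw [e1, e2, e3]; linarith

section CompleteTarget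

open Classical

variable {α β V : Type*} [Fintype α]

theorem prod_comp_eq_pow (φ : α → V) (x : V → ℝ) {u v : V} (huv : u ≠ v) :
    ∏ a, x (φ a) = x u ^ (Finset.univ.filter fun a => φ a = u).card *
      x v ^ (Finset.univ.filter fun a => φ a = v).card *
        ∏ a with φ a ≠ u ∧ φ a ≠ v, x (φ a) := by
  rw [← Finset.prod_filter_mul_prod_filter_not Finset.univ (fun a => φ a = u), mul_assoc]
  congr 1
  · rw [Finset.prod_congr rfl (g := fun _ => x u), Finset.prod_const]
    intro a ha; rw [(Finset.mem_filter.1 ha).2]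
  · rw [← Finset.prod_filter_mul_prod_filter_not _ (fun a => φ a = v),
      Finset.filter_filter, Finset.filter_filter]
    congr 1
    rw [Finset.prod_congr rfl (g := fun _ => x v), Finset.prod_const]
    · congr 2
      ext a
      simp only [Finset.mem_filter, Finset.mem_univ, true_and]
      exact ⟨fun h => h.2, fun h => ⟨by rw [h]; exact huv.symm, h⟩⟩
    · intro a ha; rw [(Finset.mem_filter.1 ha).2.2]

theorem card_fiber_of_isStrongHom_top {F : SimpleGraph α} {c : α → β}
    (hF : ∀ a b, F.Adj a b ↔ c a ≠ c b) {p : ℕ}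
    (hc : ∀ a, (Finset.univ.filter fun b => c b = c a).card = p ∨
      (Finset.univ.filter fun b => c b = c a).card = p + 1)
    {φ : α → V} (hφ : IsStrongHom F ⊤ φ) (u : V) :
    (Finset.univ.filter fun a => φ a = u).card = 0 ∨
      (Finset.univ.filter fun a => φ a = u).card = p ∨
      (Finset.univ.filter fun a => φ a = u).card = p + 1 := by
  by_cases h : ∃ a, φ a = u
  · obtain ⟨a, rfl⟩ := h
    right
    have : (Finset.univ.filter fun b => φ b = φ a) = Finset.univ.filter fun b => c b = c a := by
      ext b
      have := hφ b a
      rw [hF, SimpleGraph.top_adj, not_iff_not] at this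
      simp [this]
    rw [this]
    exact hc a
  · left
    push Not at h
    simp [h]

variable [Fintype V]

theorem strongHomWeight_top_comp_equiv (F : SimpleGraph α) (x : V → ℝ) (e : V ≃ V) :
    strongHomWeight F ⊤ (x ∘ e) = strongHomWeight F (⊤ : SimpleGraph V) x := by
  unfold strongHomWeight
  rw [← (Equiv.arrowCongr (Equiv.refl α) e).sum_comp (fun φ : α → V =>
    (∏ a, x (φ a)) * if IsStrongHom F ⊤ φ then 1 else 0)]
  refine Finset.sum_congr rfl fun φ _ => ?_
  simp [IsStrongHom, Equiv.arrowCongr]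

/-- Merging or averaging two weights: the weight in a complete graph is dominated by a convex
combination of the two outcomes. -/
theorem strongHomWeight_top_le {F : SimpleGraph α} {c : α → β}
    (hF : ∀ a b, F.Adj a b ↔ c a ≠ c b) {p : ℕ} (hp : 1 ≤ p) (hp3 : p ≤ 3)
    (hc : ∀ a, (Finset.univ.filter fun b => c b = c a).card = p ∨
      (Finset.univ.filter fun b => c b = c a).card = p + 1)
    {x : V → ℝ} (hx : ∀ v, 0 ≤ x v) {u v : V} (huv : u ≠ v) (hu : 0 < x u) (hv : 0 < x v) :
    strongHomWeight F (⊤ : SimpleGraph V) x ≤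
      (1 - 4 * x u * x v / (x u + x v) ^ 2) *
        strongHomWeight F ⊤ (Function.update (Function.update x u (x u + x v)) v 0) +
      4 * x u * x v / (x u + x v) ^ 2 *
        strongHomWeight F ⊤
          (Function.update (Function.update x u ((x u + x v) / 2)) v ((x u + x v) / 2)) := by
  set y := Function.update (Function.update x u (x u + x v)) v 0 with hy
  set z := Function.update (Function.update x u ((x u + x v) / 2)) v ((x u + x v) / 2) with hz
  set μ := 4 * x u * x v / (x u + x v) ^ 2 with hμ
  suffices h : strongHomWeight F ⊤ x + strongHomWeight F ⊤ (x ∘ Equiv.swap u v) ≤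
      (1 - μ) * (strongHomWeight F ⊤ y + strongHomWeight F ⊤ (y ∘ Equiv.swap u v)) +
        μ * (2 * strongHomWeight F ⊤ z) by
    rw [strongHomWeight_top_comp_equiv, strongHomWeight_top_comp_equiv] at h
    linarith
  simp only [strongHomWeight]
  rw [← Finset.sum_add_distrib, ← Finset.sum_add_distrib, Finset.mul_sum, Finset.mul_sum,
    Finset.mul_sum, ← Finset.sum_add_distrib]
  refine Finset.sum_le_sum fun φ _ => ?_
  by_cases hφ : IsStrongHom F ⊤ φ
  swap
  · simp [hφ]
  have hcard := card_fiber_of_isStrongHom_top hF hc hφ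
  have hR : 0 ≤ ∏ a with φ a ≠ u ∧ φ a ≠ v, x (φ a) := Finset.prod_nonneg fun a _ => hx _
  have hother : ∀ w : V → ℝ, (∀ b, b ≠ u → b ≠ v → w b = x b) →
      ∏ a with φ a ≠ u ∧ φ a ≠ v, w (φ a) = ∏ a with φ a ≠ u ∧ φ a ≠ v, x (φ a) := by
    intro w hw
    refine Finset.prod_congr rfl fun a ha => ?_
    simp only [Finset.mem_filter] at ha
    exact hw _ ha.2.1 ha.2.2
  simp only [hφ, if_true, mul_one]
  rw [prod_comp_eq_pow φ x huv, prod_comp_eq_pow φ (x ∘ _) huv, prod_comp_eq_pow φ y huv,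
    prod_comp_eq_pow φ (y ∘ _) huv, prod_comp_eq_pow φ z huv]
  rw [hother (x ∘ Equiv.swap u v), hother y, hother (y ∘ Equiv.swap u v), hother z]
  · have key := mul_le_mul_of_nonneg_right
      (pair_inequality hu hv hp hp3 (hcard u) (hcard v)) hR
    have yu : y u = x u + x v := by simp [hy, huv]
    have yv : y v = 0 := by simp [hy]
    have zu : z u = (x u + x v) / 2 := by simp [hz, huv]
    have zv : z v = (x u + x v) / 2 := by simp [hz]
    simp only [Function.comp, Equiv.swap_apply_left, Equiv.swap_apply_right, yu, yv, zu, zv]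
    rw [← hμ] at key
    refine le_trans (le_of_eq ?_) (key.trans (le_of_eq ?_)) <;> ring
  · intro b h1 h2; simp [hz, h1, h2]
  · intro b h1 h2; simp [hy, Equiv.swap_apply_of_ne_of_ne h1 h2, h1, h2]
  · intro b h1 h2; simp [hy, h1, h2]
  · intro b h1 h2; simp [Equiv.swap_apply_of_ne_of_ne h1 h2]

theorem card_isStrongHom_top [Fintype β] {F : SimpleGraph α} {c : α → β}
    (hF : ∀ a b, F.Adj a b ↔ c a ≠ c b) (hsurj : Function.Surjective c) :
    (Finset.univ.filter fun φ : α → V => IsStrongHom F ⊤ φ).card =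
      (Fintype.card V).descFactorial (Fintype.card β) := by
  rw [← Fintype.card_embedding_eq, ← Finset.card_univ]
  symm
  refine Finset.card_bij (fun σ _ => σ ∘ c) ?_ ?_ ?_
  · intro σ _
    simp only [Finset.mem_filter, Finset.mem_univ, true_and]
    intro a b
    simp [hF]
  · intro σ _ τ _ h
    ext b
    obtain ⟨a, rfl⟩ := hsurj b
    exact congrFun h a
  · intro φ hφ
    simp only [Finset.mem_filter, Finset.mem_univ, true_and] at hφ
    have h : ∀ a b, φ a = φ b ↔ c a = c b := by
      intro a b
      have := hφ a b
      rw [hF, SimpleGraph.top_adj, not_iff_not] at this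
      exact this.symm
    refine ⟨⟨fun b => φ (Function.surjInv hsurj b), fun b b' hb => ?_⟩, Finset.mem_univ _, ?_⟩
    · have := (h _ _).1 hb
      rwa [Function.surjInv_eq hsurj, Function.surjInv_eq hsurj] at this
    · funext a
      exact (h _ _).2 (Function.surjInv_eq hsurj _)

theorem strongHomWeight_const (F : SimpleGraph α) (G : SimpleGraph V) (x : ℝ) :
    strongHomWeight F G (fun _ => x) =
      (Finset.univ.filter fun φ : α → V => IsStrongHom F G φ).card * x ^ Fintype.card α := by
  simp only [strongHomWeight, Finset.prod_const, Finset.card_univ]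
  rw [← Finset.mul_sum, Finset.sum_boole, mul_comm]

theorem continuous_strongHomWeight (F : SimpleGraph α) (G : SimpleGraph V) :
    Continuous (strongHomWeight F G) := by
  unfold strongHomWeight
  fun_prop

theorem strongHomWeight_top_le_of_const [Fintype β] {F : SimpleGraph α} {c : α → β}
    (hF : ∀ a b, F.Adj a b ↔ c a ≠ c b) (hsurj : Function.Surjective c)
    {p : ℕ} (hp : 1 ≤ p) (hp3 : p ≤ 3)
    (hc : ∀ a, (Finset.univ.filter fun b => c b = c a).card = p ∨
      (Finset.univ.filter fun b => c b = c a).card = p + 1)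
    {M : ℝ} (hM : ∀ l : ℕ, 1 ≤ l → l ≤ Fintype.card V →
      (l.descFactorial (Fintype.card β) : ℝ) / (l : ℝ) ^ Fintype.card α ≤ M)
    {x : V → ℝ} (hx : x ∈ stdSimplex ℝ V) : strongHomWeight F (⊤ : SimpleGraph V) x ≤ M := by
  obtain ⟨x₀, hx₀, hmax₀⟩ := (isCompact_stdSimplex ℝ V).exists_isMaxOn ⟨x, hx⟩
    (continuous_strongHomWeight F (⊤ : SimpleGraph V)).continuousOn
  let P : ℕ → Prop := fun N => ∃ y ∈ stdSimplex ℝ V,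
    IsMaxOn (strongHomWeight F (⊤ : SimpleGraph V)) (stdSimplex ℝ V) y ∧
      (Finset.univ.filter fun v => y v ≠ 0).card = N
  have hP : ∃ N, P N := ⟨_, x₀, hx₀, hmax₀, rfl⟩
  obtain ⟨y, hy, hmax, hcard⟩ := Nat.find_spec hP
  have hmin : ∀ N < Nat.find hP, ¬ P N := fun N => Nat.find_min hP
  have heq : ∀ u v, 0 < y u → 0 < y v → y u = y v := by
    intro u v hu hv
    by_contra hne
    have huv : u ≠ v := fun h => hne (by rw [h])
    have main := strongHomWeight_top_le hF hp hp3 hc hy.1 huv hu hv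
    set μ := 4 * y u * y v / (y u + y v) ^ 2 with hμ
    have hμ0 : 0 ≤ μ := by positivity
    have hμ1 : μ < 1 := by
      rw [hμ, div_lt_one (by positivity)]
      nlinarith [sq_pos_of_ne_zero (sub_ne_zero.2 hne)]
    have simplex : ∀ a b : ℝ, 0 ≤ a → 0 ≤ b → a + b = y u + y v →
        Function.update (Function.update y u a) v b ∈ stdSimplex ℝ V := by
      intro a b ha hb hab
      refine ⟨fun w => ?_, ?_⟩
      · by_cases h1 : w = v
        · subst h1; simpa using hb
        · by_cases h2 : w = u
          · subst h2; simpa [h1] using ha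
          · simpa [h1, h2] using hy.1 w
      · have h2 := hy.2
        rw [← Finset.add_sum_erase _ _ (Finset.mem_univ u),
          ← Finset.add_sum_erase _ _ (show v ∈ Finset.univ.erase u by simp [huv.symm])] at h2 ⊢
        rw [← h2]
        have : ∑ w ∈ (Finset.univ.erase u).erase v,
            Function.update (Function.update y u a) v b w =
            ∑ w ∈ (Finset.univ.erase u).erase v, y w := by
          refine Finset.sum_congr rfl fun w hw => ?_
          simp only [Finset.mem_erase] at hw
          simp [hw.1, hw.2.1]
        rw [this]
        simp [huv]
        linarith
    have s1 := simplex (y u + y v) 0 (by linarith) le_rfl (by ring)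
    have s2 := simplex ((y u + y v) / 2) ((y u + y v) / 2) (by linarith) (by linarith) (by ring)
    set y₁ := Function.update (Function.update y u (y u + y v)) v 0 with hy₁
    have m1 := hmax s1
    have m2 := hmax s2
    simp only [Set.mem_ofPred_eq] at m1 m2
    have hge : strongHomWeight F (⊤ : SimpleGraph V) y ≤ strongHomWeight F ⊤ y₁ := by
      have h3 := mul_le_mul_of_nonneg_left m2 hμ0
      by_contra hlt
      push Not at hlt
      have h4 := mul_lt_mul_of_pos_left hlt (sub_pos.2 hμ1)
      linarith
    refine hmin (Finset.univ.filter fun w => y₁ w ≠ 0).card ?_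
      ⟨y₁, s1, fun w hw => (hmax hw).trans hge, rfl⟩
    rw [← hcard]
    refine Finset.card_lt_card (Finset.ssubset_iff_of_subset ?_ |>.2 ⟨v, ?_, ?_⟩)
    · intro w
      simp only [Finset.mem_filter, Finset.mem_univ, true_and, hy₁]
      by_cases h1 : w = v
      · simp [h1]
      · by_cases h2 : w = u
        · subst h2; intro _; exact hu.ne'
        · simp [h1, h2]
    · simp [hv.ne']
    · simp [hy₁]
  set K := Finset.univ.filter fun v => y v ≠ 0 with hK
  have hKne : K.Nonempty := by
    by_contra h
    rw [Finset.not_nonempty_iff_eq_empty] at h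
    have h1 := hy.2
    rw [Finset.sum_eq_zero] at h1
    · exact zero_ne_one h1
    · intro v _
      by_contra hv
      have : v ∈ K := by simp [hK, hv]
      rw [h] at this
      simp at this
  obtain ⟨u, hu⟩ := hKne
  have hpos : ∀ v ∈ K, 0 < y v := fun v hv =>
    lt_of_le_of_ne (hy.1 v) (Ne.symm (Finset.mem_filter.1 hv).2)
  have hval : ∀ v ∈ K, y v = 1 / (K.card : ℝ) := by
    intro v hv
    have h1 := hy.2
    rw [← Finset.sum_subset (Finset.subset_univ K)
      (fun w _ hw => by simpa [hK] using hw),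
      Finset.sum_congr rfl (fun w hw => heq w v (hpos w hw) (hpos v hv)), Finset.sum_const,
      nsmul_eq_mul] at h1
    have : (K.card : ℝ) ≠ 0 := by
      have := Finset.card_pos.2 ⟨v, hv⟩
      positivity
    field_simp
    linarith
  refine (hmax hx).trans ?_
  rw [strongHomWeight_induce F ⊤ y K (fun v hv => by simpa [hK] using hv)]
  have e : (fun v : (K : Set V) => y v) = fun _ => 1 / (K.card : ℝ) := by
    funext v
    exact hval v v.2
  have hcl : ((⊤ : SimpleGraph V).induce (K : Set V)) = ⊤ := by
    ext a b
    rw [SimpleGraph.comap_adj, SimpleGraph.top_adj, SimpleGraph.top_adj]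
    exact Subtype.val_injective.ne_iff
  rw [e, hcl, strongHomWeight_const, card_isStrongHom_top hF hsurj]
  have := hM K.card (Finset.card_pos.2 ⟨u, hu⟩) (Finset.card_le_univ K)
  have hKc : Fintype.card (K : Set V) = K.card := by simp
  rw [hKc, one_div, inv_pow, ← div_eq_mul_inv]
  exact this

end CompleteTarget

theorem turanRatio_le_one_iff {r l : ℕ} (s : ℕ) (hl : r < l) :
    turanRatio r s l ≤ 1 ↔ (1 - 1 / (l : ℝ)) ^ s ≤ 1 - r * (1 / (l : ℝ)) := by
  have h0 : (0 : ℝ) < l := by exact_mod_cast (Nat.zero_le r).trans_lt hl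
  have h1 : (0 : ℝ) < (l : ℝ) - r := sub_pos.2 (by exact_mod_cast hl)
  have h2 : (1 : ℝ) - r * (1 / l) = (l - r) / l := by field_simp
  rw [turanRatio, h2, le_div_iff₀ h0, div_mul_eq_mul_div, div_le_one h1, mul_comm]

/-- Once the ratio has dropped to at most `1`, it stays there. -/
theorem turanRatio_le_one_of_le {r s a b : ℕ} (ha : r < a) (hab : a ≤ b)
    (h : turanRatio r s a ≤ 1) : turanRatio r s b ≤ 1 := by
  rw [turanRatio_le_one_iff s ha] at h
  rw [turanRatio_le_one_iff s (ha.trans_le hab)]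
  have ha0 : (0 : ℝ) < a := by exact_mod_cast (Nat.zero_le r).trans_lt ha
  have hb0 : (0 : ℝ) < b := ha0.trans_le (by exact_mod_cast hab)
  have ha1 : (1 : ℝ) ≤ a := by exact_mod_cast (Nat.zero_le r).trans_lt ha
  set θ : ℝ := a / b with hθ
  have hθ0 : 0 ≤ θ := by positivity
  have hθ1 : θ ≤ 1 := by rw [hθ, div_le_one hb0]; exact_mod_cast hab
  have hy : 1 / (b : ℝ) = θ * (1 / a) := by rw [hθ]; field_simp
  have h1 : (0 : ℝ) ≤ 1 - 1 / a := by
    rw [sub_nonneg, div_le_one ha0]; exact ha1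
  have hconv := (convexOn_pow s (𝕜 := ℝ)).2 (x := 1 - 1 / (a : ℝ)) (Set.mem_Ici.2 h1)
    (y := 1) (Set.mem_Ici.2 zero_le_one) hθ0 (sub_nonneg.2 hθ1) (by ring)
  simp only [smul_eq_mul, one_pow, mul_one] at hconv
  rw [hy]
  calc (1 - θ * (1 / (a : ℝ))) ^ s = (θ * (1 - 1 / a) + (1 - θ)) ^ s := by congr 1; ring
    _ ≤ θ * (1 - 1 / a) ^ s + (1 - θ) := hconv
    _ ≤ θ * (1 - r * (1 / a)) + (1 - θ) := by gcongr
    _ = _ := by ring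

theorem descFactorial_div_pow_succ {r s l : ℕ} (hr : 1 ≤ r) (hl : r ≤ l) :
    ((l + 1).descFactorial r : ℝ) / ((l + 1 : ℕ) : ℝ) ^ s =
      (l.descFactorial r : ℝ) / (l : ℝ) ^ s * turanRatio r s (l + 1) := by
  have h := Nat.succ_descFactorial l r
  have h' : ((l : ℝ) + 1 - r) * ((l + 1).descFactorial r : ℝ) = (l + 1) * l.descFactorial r := by
    rw [← Nat.cast_add_one, ← Nat.cast_sub (by omega)]
    exact_mod_cast h
  have h0 : (0 : ℝ) < l := by exact_mod_cast (by omega : 0 < l)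
  have h1 : (0 : ℝ) < (l : ℝ) + 1 - r := by
    have : (r : ℝ) ≤ l := by exact_mod_cast hl
    linarith
  have h2 : (1 : ℝ) - 1 / (l + 1) = l / (l + 1) := by field_simp; ring
  have h3 : ((l + 1).descFactorial r : ℝ) = (l + 1) * l.descFactorial r / (l + 1 - r) := by
    rw [eq_div_iff h1.ne', ← h', mul_comm]
  rw [turanRatio]
  push_cast
  rw [h2, h3, div_pow]
  field_simp

theorem descFactorial_div_pow_le {r s t m l : ℕ} (hr : 1 ≤ r) (hrm : r ≤ m)
    (ht : (r + 1 ≤ t ∧ 1 < turanRatio r s t ∧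
            ∀ ℓ : ℕ, r + 1 ≤ ℓ → 1 < turanRatio r s ℓ → ℓ ≤ t) ∨
          (t = r ∧ ∀ ℓ : ℕ, r + 1 ≤ ℓ → ¬ 1 < turanRatio r s ℓ)) (hlm : l ≤ m) :
    (l.descFactorial r : ℝ) / (l : ℝ) ^ s ≤
      ((min m t).descFactorial r : ℝ) / ((min m t : ℕ) : ℝ) ^ s := by
  obtain ⟨hrt, hup, hdown⟩ : r ≤ t ∧ (∀ l, r + 1 ≤ l → l ≤ t → 1 ≤ turanRatio r s l) ∧
      ∀ l, t + 1 ≤ l → turanRatio r s l ≤ 1 := by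
    rcases ht with ⟨h1, h2, h3⟩ | ⟨rfl, h⟩
    · refine ⟨by omega, fun l hl hlt => ?_, fun l hl => ?_⟩
      · by_contra hcon
        exact absurd (turanRatio_le_one_of_le hl hlt (not_le.1 hcon).le) (not_le.2 h2)
      · by_contra hcon
        have := h3 l (by omega) (not_le.1 hcon)
        omega
    · exact ⟨le_rfl, fun l h1 h2 => by omega, fun l hl => not_lt.1 (h l hl)⟩
  have hnonneg : ∀ l : ℕ, (0 : ℝ) ≤ (l.descFactorial r : ℝ) / (l : ℝ) ^ s := fun l => by positivity
  by_cases hlr : l < r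
  · rw [Nat.descFactorial_eq_zero_iff_lt.2 hlr]
    simpa using hnonneg (min m t)
  push Not at hlr
  have mono : ∀ a, r ≤ a → ∀ b, a ≤ b → b ≤ t →
      (a.descFactorial r : ℝ) / (a : ℝ) ^ s ≤ (b.descFactorial r : ℝ) / (b : ℝ) ^ s := by
    intro a ha b hab
    induction b, hab using Nat.le_induction with
    | base => intro _; exact le_rfl
    | succ b hab ih =>
      intro hb
      rw [descFactorial_div_pow_succ hr (ha.trans hab)]
      exact (ih (by omega)).trans
        (le_mul_of_one_le_right (hnonneg b) (hup _ (by omega) hb))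
  by_cases hlt : l ≤ t
  · exact mono l hlr _ (le_min hlm hlt) (min_le_right _ _)
  · rw [min_eq_right (by omega)]
    have : t ≤ l := by omega
    clear hlm hlt hlr
    induction l, this using Nat.le_induction with
    | base => exact le_rfl
    | succ b hb ih =>
      rw [descFactorial_div_pow_succ hr (hrt.trans hb)]
      exact (mul_le_of_le_one_right (hnonneg b) (hdown _ (by omega))).trans ih

section Counting

open Classical

variable {α β : Type*}

theorem card_iso_eq_card_perm {c : α → β} {F : SimpleGraph α}
    (hF : ∀ a b, F.Adj a b ↔ c a ≠ c b) :
    Nat.card (F ≃g F) =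
      Nat.card {g : Equiv.Perm α // ∀ a b, c a = c b ↔ c (g a) = c (g b)} := by
  refine Nat.card_congr
    { toFun := fun f => ⟨f.toEquiv, fun a b => ?_⟩
      invFun := fun g => ⟨g.1, fun {a b} => ?_⟩
      left_inv := fun f => rfl
      right_inv := fun g => rfl }
  · have := f.map_rel_iff' (a := a) (b := b)
    rw [hF, hF, not_iff_not] at this
    exact this.symm
  · rw [hF, hF, not_iff_not]
    exact (g.2 a b).symm

variable [Fintype α] [Fintype β]

/-- The number of permutations that preserve the partition into the fibers of `c`. -/
theorem card_perm_preserving_fibers {c : α → β} (hc : Function.Surjective c) :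
    Nat.card {g : Equiv.Perm α // ∀ a b, c a = c b ↔ c (g a) = c (g b)} =
      Nat.card {σ : Equiv.Perm β //
        ∀ i, Fintype.card {a // c a = σ i} = Fintype.card {a // c a = i}} *
      ∏ i, (Fintype.card {a // c a = i}).factorial := by
  let Φ : (Σ σ : Equiv.Perm β, {g : Equiv.Perm α // ∀ a, c (g a) = σ (c a)}) →
      {g : Equiv.Perm α // ∀ a b, c a = c b ↔ c (g a) = c (g b)} :=
    fun z => ⟨z.2.1, fun a b => by rw [z.2.2, z.2.2, z.1.injective.eq_iff]⟩
  have hΦ : Function.Bijective Φ := by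
    constructor
    · rintro ⟨σ, g, hg⟩ ⟨τ, g', hg'⟩ h
      have h1 : g = g' := congrArg Subtype.val h
      subst h1
      have h2 : σ = τ := by
        ext i
        obtain ⟨a, rfl⟩ := hc i
        rw [← hg, ← hg']
      subst h2
      rfl
    · rintro ⟨g, hg⟩
      have hf : ∀ a, c (g (Function.surjInv hc (c a))) = c (g a) := fun a =>
        (hg _ _).1 (Function.surjInv_eq hc _)
      have hinj : Function.Injective fun i => c (g (Function.surjInv hc i)) := by
        intro i j hij
        have := (hg _ _).2 hij
        rwa [Function.surjInv_eq hc, Function.surjInv_eq hc] at this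
      exact ⟨⟨Equiv.ofBijective _ (Finite.injective_iff_bijective.1 hinj), g,
        fun a => (hf a).symm⟩, rfl⟩
  rw [← Nat.card_congr (Equiv.ofBijective Φ hΦ), Nat.card_sigma]
  have hfib : ∀ σ : Equiv.Perm β,
      Nat.card {g : Equiv.Perm α // ∀ a, c (g a) = σ (c a)} =
      if ∀ i, Fintype.card {a // c a = σ i} = Fintype.card {a // c a = i} then
        ∏ i, (Fintype.card {a // c a = i}).factorial else 0 := by
    intro σ
    split_ifs with h
    · let g₀ : Equiv.Perm α := Equiv.ofFiberEquiv (f := fun a => σ (c a)) (g := c) fun i =>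
        Fintype.equivOfCardEq (by
          rw [← σ.apply_symm_apply i, h]
          simp only [EmbeddingLike.apply_eq_iff_eq])
      have hg₀ : ∀ a, c (g₀ a) = σ (c a) := fun a => Equiv.ofFiberEquiv_map _ a
      rw [← DomMulAct.stabilizer_card c, ← Nat.card_eq_fintype_card]
      refine (Nat.card_congr ((Equiv.mulLeft g₀).subtypeEquiv fun g => ?_)).symm
      simp only [funext_iff, Function.comp, Equiv.coe_mulLeft, Equiv.Perm.coe_mul, hg₀,
        EmbeddingLike.apply_eq_iff_eq]
    · rw [Nat.card_eq_zero]
      left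
      constructor
      rintro ⟨g, hg⟩
      refine h fun i => (Fintype.card_congr (g.subtypeEquiv fun a => ?_)).symm
      rw [hg, EmbeddingLike.apply_eq_iff_eq]
  simp_rw [hfib]
  rw [← Finset.sum_filter, Finset.sum_const, smul_eq_mul, Nat.card_eq_fintype_card,
    Fintype.card_subtype]

theorem card_embedding_eq_inducedCount_mul (F : SimpleGraph α) (G : SimpleGraph β) :
    Nat.card (F ↪g G) = inducedCount F G * Nat.card (F ≃g F) := by
  let S : Set (Finset β) := {s | s.card = Fintype.card α ∧
    Nonempty (F ≃g SimpleGraph.induce (↑s : Set β) G)}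
  let Φ : (Σ s : S, (F ≃g SimpleGraph.induce (↑(s : Finset β) : Set β) G)) → (F ↪g G) :=
    fun z => (SimpleGraph.Embedding.induce _).comp z.2.toEmbedding
  have hΦ : Function.Bijective Φ := by
    constructor
    · rintro ⟨⟨s, hs⟩, e⟩ ⟨⟨s', hs'⟩, e'⟩ h
      have hval : ∀ a, ((e a : (s : Set β)) : β) = (e' a : (s' : Set β)) := fun a =>
        DFunLike.congr_fun h a
      have : s = s' := by
        ext b
        constructor
        · intro hb
          have h1 := hval (e.symm ⟨b, hb⟩)
          rw [RelIso.apply_symm_apply] at h1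
          have h2 := (e' (e.symm ⟨b, hb⟩)).2
          rw [← h1] at h2
          exact h2
        · intro hb
          have h1 := hval (e'.symm ⟨b, hb⟩)
          rw [RelIso.apply_symm_apply] at h1
          have h2 := (e (e'.symm ⟨b, hb⟩)).2
          rw [h1] at h2
          exact h2
      subst this
      congr 1
      ext a
      exact hval a
    · intro f
      let s : Finset β := Finset.univ.map f.toEmbedding
      have hmem : ∀ a, f a ∈ (s : Set β) := fun a => by simp [s]
      let e : F ≃g SimpleGraph.induce (↑s : Set β) G :=
        { toEquiv := Equiv.ofBijective (fun a => (⟨f a, hmem a⟩ : (s : Set β)))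
            ⟨fun a b h => f.injective (congrArg Subtype.val h), fun ⟨b, hb⟩ => by
              obtain ⟨a, -, rfl⟩ := Finset.mem_map.1 (Finset.mem_coe.1 hb)
              exact ⟨a, rfl⟩⟩
          map_rel_iff' := fun {a b} => f.map_rel_iff' }
      exact ⟨⟨⟨s, by simp [s], ⟨e⟩⟩, e⟩, by ext a; rfl⟩
  have hfin : ∀ t : S, Finite (F ≃g SimpleGraph.induce (↑(t : Finset β) : Set β) G) :=
    fun t => Finite.of_injective _ DFunLike.coe_injective
  rw [← Nat.card_congr (Equiv.ofBijective Φ hΦ), Nat.card_sigma,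
    Finset.sum_congr rfl (g := fun _ => Nat.card (F ≃g F))]
  · rw [Finset.sum_const, smul_eq_mul, Finset.card_univ, ← Nat.card_eq_fintype_card]
    rfl
  · rintro ⟨s, hs, ⟨e⟩⟩ _
    exact Nat.card_congr
      { toFun := fun f => f.trans e.symm
        invFun := fun f => f.trans e
        left_inv := fun f => by ext a; simp
        right_inv := fun f => by ext a; simp }

theorem card_filter_fin_mod (n : ℕ) {l i : ℕ} (hi : i < l) :
    (Finset.univ.filter fun a : Fin n => (a : ℕ) % l = i).card =
      n / l + if i < n % l then 1 else 0 := by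
  have h := Nat.count_modEq_card n (r := l) (by omega) i
  rw [Nat.mod_eq_of_lt hi, Nat.count_eq_card_filter_range] at h
  rw [← h, ← Finset.card_map Fin.valEmbedding]
  congr 1
  ext b
  simp only [Finset.mem_map, Finset.mem_filter, Finset.mem_univ, true_and, Finset.mem_range,
    Fin.valEmbedding_apply, Nat.ModEq, Nat.mod_eq_of_lt hi]
  constructor
  · rintro ⟨a, ha, rfl⟩
    exact ⟨a.2, ha⟩
  · rintro ⟨h1, h2⟩
    exact ⟨⟨b, h1⟩, h2, rfl⟩

theorem card_turanGraph_aut {r s p q : ℕ} (hr : 1 ≤ r) (hrs : r ≤ s)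
    (hspq : s = p * r + q) (hq : q < r) :
    Nat.card (SimpleGraph.turanGraph s r ≃g SimpleGraph.turanGraph s r) =
      (r - q).factorial * q.factorial * p.factorial ^ r * (p + 1) ^ q := by
  let c : Fin s → Fin r := fun a => ⟨a % r, Nat.mod_lt _ hr⟩
  have hF : ∀ a b, (SimpleGraph.turanGraph s r).Adj a b ↔ c a ≠ c b := fun a b => by
    simp [SimpleGraph.turanGraph_adj, c]
  have hsurj : Function.Surjective c := fun i =>
    ⟨⟨i, i.2.trans_le hrs⟩, by ext; simp [c, Nat.mod_eq_of_lt i.2]⟩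
  have hdiv : s / r = p := by
    rw [hspq, mul_comm, Nat.mul_add_div hr, Nat.div_eq_of_lt hq, add_zero]
  have hmod : s % r = q := by
    rw [hspq, mul_comm, Nat.mul_add_mod, Nat.mod_eq_of_lt hq]
  have hcard : ∀ i, ∀ _ : Fintype {a // c a = i},
      Fintype.card {a // c a = i} = p + if (i : ℕ) < q then 1 else 0 := by
    intro i _
    have := card_filter_fin_mod s i.2
    rw [hdiv, hmod] at this
    rw [← this]
    exact Fintype.card_of_subtype _ fun a => by simp [c, Fin.ext_iff]
  rw [card_iso_eq_card_perm hF, card_perm_preserving_fibers hsurj]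
  simp_rw [hcard]
  have hlt : (Finset.univ.filter fun i : Fin r => (i : ℕ) < q).card = q := by
    rw [Fin.card_filter_val_lt]; omega
  have hge : (Finset.univ.filter fun i : Fin r => ¬ (i : ℕ) < q).card = r - q := by
    have := Finset.card_filter_add_card_filter_not (s := (Finset.univ : Finset (Fin r)))
      (fun i : Fin r => (i : ℕ) < q)
    rw [hlt, Finset.card_univ, Fintype.card_fin] at this
    omega
  have hperm : Nat.card {σ : Equiv.Perm (Fin r) //
      ∀ i, (p + if (σ i : ℕ) < q then 1 else 0) = p + if (i : ℕ) < q then 1 else 0} =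
      q.factorial * (r - q).factorial := by
    have := DomMulAct.stabilizer_card (fun i : Fin r => decide ((i : ℕ) < q))
    have h1 : Fintype.card {i : Fin r // decide ((i : ℕ) < q) = true} = q :=
      (Fintype.card_of_subtype _ fun i => by simp).trans hlt
    have h2 : Fintype.card {i : Fin r // decide ((i : ℕ) < q) = false} = r - q :=
      (Fintype.card_of_subtype _ fun i => by simp).trans hge
    rw [Fintype.prod_bool, h1, h2, ← Nat.card_eq_fintype_card] at this
    rw [← this]
    refine Nat.card_congr (Equiv.subtypeEquivRight fun σ => ?_)
    rw [funext_iff]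
    refine forall_congr' fun i => ?_
    simp only [Function.comp, decide_eq_decide]
    by_cases h1 : (σ i : ℕ) < q <;> by_cases h2 : (i : ℕ) < q <;> simp [h1, h2]
  have hprod : ∏ i : Fin r, (p + if (i : ℕ) < q then 1 else 0).factorial =
      p.factorial ^ r * (p + 1) ^ q := by
    have : ∀ i : Fin r, (p + if (i : ℕ) < q then 1 else 0).factorial =
        p.factorial * if (i : ℕ) < q then p + 1 else 1 := by
      intro i
      split_ifs
      · rw [Nat.factorial_succ, mul_comm]
      · simp
    simp_rw [this]
    rw [Finset.prod_mul_distrib, Finset.prod_const, Finset.prod_ite, Finset.prod_const, hlt]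
    simp
  rw [hperm, hprod]
  ring

end Counting

section Assembly

open Classical

variable {α β V : Type*} [Fintype α] [Fintype β] [Fintype V]

theorem strongHomWeight_le_of_cliqueFree {F : SimpleGraph α} {c : α → β}
    (hF : ∀ a b, F.Adj a b ↔ c a ≠ c b) (hsurj : Function.Surjective c)
    {p : ℕ} (hp : 1 ≤ p) (hp3 : p ≤ 3)
    (hc : ∀ a, (Finset.univ.filter fun b => c b = c a).card = p ∨
      (Finset.univ.filter fun b => c b = c a).card = p + 1)
    {k : ℕ} {M : ℝ} (hM : ∀ l : ℕ, 1 ≤ l → l < k →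
      (l.descFactorial (Fintype.card β) : ℝ) / (l : ℝ) ^ Fintype.card α ≤ M)
    {G : SimpleGraph V} (hG : G.CliqueFree k) {x : V → ℝ} (hx : x ∈ stdSimplex ℝ V) :
    strongHomWeight F G x ≤ M := by
  refine strongHomWeight_le_of_clique (fun a b d h1 h2 => ?_) (fun y hy hcl => ?_) hx
  · rw [hF, not_not] at *
    exact h1.trans h2
  set K := Finset.univ.filter fun v => y v ≠ 0 with hK
  have hKcl : G.IsClique (K : Set V) := by simpa [hK] using hcl
  have htop : G.induce (K : Set V) = ⊤ := by
    ext a b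
    rw [SimpleGraph.comap_adj, SimpleGraph.top_adj]
    exact ⟨fun h => fun h' => G.ne_of_adj h (congrArg Subtype.val h'),
      fun h => hKcl a.2 b.2 (Subtype.val_injective.ne h)⟩
  have hcard : K.card < k := by
    by_contra h
    exact hG.mono (not_lt.1 h) K ⟨hKcl, rfl⟩
  rw [strongHomWeight_induce F G y K (fun v hv => by simpa [hK] using hv), htop]
  refine strongHomWeight_top_le_of_const hF hsurj hp hp3 hc (fun l h1 h2 => hM l h1 ?_)
    ⟨fun v => hy.1 v, ?_⟩
  · have : Fintype.card (K : Set V) = K.card := by simp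
    omega
  · rw [← hy.2, ← Finset.sum_subset (Finset.subset_univ K)
      (fun w _ hw => by simpa [hK] using hw)]
    exact (Finset.sum_coe_sort K y)

theorem card_embedding_le_card_isStrongHom (F : SimpleGraph α) (G : SimpleGraph V) :
    Nat.card (F ↪g G) ≤ (Finset.univ.filter fun φ : α → V => IsStrongHom F G φ).card := by
  rw [← Fintype.card_subtype, ← Nat.card_eq_fintype_card]
  refine Nat.card_le_card_of_injective
    (fun f : F ↪g G => (⟨f, fun a b => f.map_adj_iff.symm⟩ : {φ : α → V // IsStrongHom F G φ})) ?_
  intro f g h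
  exact DFunLike.coe_injective (congrArg Subtype.val h)

theorem card_isStrongHom_add_descFactorial_le (F : SimpleGraph α) (G : SimpleGraph V) :
    (Finset.univ.filter fun φ : α → V => IsStrongHom F G φ).card +
        (Fintype.card V).descFactorial (Fintype.card α) ≤
      Nat.card (F ↪g G) + Fintype.card V ^ Fintype.card α := by
  set S := Finset.univ.filter fun φ : α → V => IsStrongHom F G φ
  set I := Finset.univ.filter fun φ : α → V => Function.Injective φ
  have hI : I.card = (Fintype.card V).descFactorial (Fintype.card α) := by
    rw [← Fintype.card_embedding_eq, ← Fintype.card_subtype]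
    exact Fintype.card_congr (Equiv.subtypeInjectiveEquivEmbedding α V)
  have hSI : (S ∩ I).card ≤ Nat.card (F ↪g G) := by
    rw [← Fintype.card_coe, ← Nat.card_eq_fintype_card]
    have hfin : Finite (F ↪g G) := Finite.of_injective _ DFunLike.coe_injective
    refine Nat.card_le_card_of_injective (fun φ : {φ // φ ∈ S ∩ I} =>
      (⟨⟨φ.1, (Finset.mem_filter.1 (Finset.mem_inter.1 φ.2).2).2⟩, fun {a b} =>
        ((Finset.mem_filter.1 (Finset.mem_inter.1 φ.2).1).2 a b).symm⟩ : F ↪g G)) ?_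
    intro φ ψ h
    exact Subtype.ext (congrArg (fun f : F ↪g G => (f : α → V)) h)
  have hU : (S ∪ I).card ≤ Fintype.card V ^ Fintype.card α := by
    rw [← Fintype.card_fun]
    exact Finset.card_le_univ _
  have := Finset.card_union_add_card_inter S I
  omega

theorem strongHomWeight_uniform_mul_pow (F : SimpleGraph α) (G : SimpleGraph V)
    {n : ℕ} (hn : 1 ≤ n) :
    strongHomWeight F G (fun _ => 1 / (n : ℝ)) * (n : ℝ) ^ Fintype.card α =
      (Finset.univ.filter fun φ : α → V => IsStrongHom F G φ).card := by
  have : (n : ℝ) ≠ 0 := by exact_mod_cast (by omega : n ≠ 0)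
  rw [strongHomWeight_const, mul_assoc, ← mul_pow, one_div_mul_cancel this, one_pow, mul_one]

theorem card_embedding_le_strongHomWeight (F : SimpleGraph α) (G : SimpleGraph V)
    {n : ℕ} (hn : 1 ≤ n) :
    (Nat.card (F ↪g G) : ℝ) ≤
      strongHomWeight F G (fun _ => 1 / (n : ℝ)) * (n : ℝ) ^ Fintype.card α := by
  rw [strongHomWeight_uniform_mul_pow F G hn]
  exact_mod_cast card_embedding_le_card_isStrongHom F G

theorem strongHomWeight_add_descFactorial_le (F : SimpleGraph α) (G : SimpleGraph V)
    {n : ℕ} (hn : 1 ≤ n) :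
    strongHomWeight F G (fun _ => 1 / (n : ℝ)) * (n : ℝ) ^ Fintype.card α +
        ((Fintype.card V).descFactorial (Fintype.card α) : ℝ) ≤
      (Nat.card (F ↪g G) : ℝ) + (Fintype.card V : ℝ) ^ Fintype.card α := by
  rw [strongHomWeight_uniform_mul_pow F G hn]
  exact_mod_cast card_isStrongHom_add_descFactorial_le F G

theorem strongHomWeight_top_const {F : SimpleGraph α} {c : α → β}
    (hF : ∀ a b, F.Adj a b ↔ c a ≠ c b) (hsurj : Function.Surjective c) (x : ℝ) :
    strongHomWeight F (⊤ : SimpleGraph V) (fun _ => x) =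
      (Fintype.card V).descFactorial (Fintype.card β) * x ^ Fintype.card α := by
  rw [strongHomWeight_const, card_isStrongHom_top hF hsurj]

theorem strongHomWeight_turanGraph (F : SimpleGraph α) (n : ℕ) {l : ℕ} (hl : 0 < l) (w : ℝ) :
    strongHomWeight F (SimpleGraph.turanGraph n l) (fun _ => w) =
      strongHomWeight F (⊤ : SimpleGraph (Fin l))
        (fun i => ((n / l + if (i : ℕ) < n % l then 1 else 0 : ℕ) : ℝ) * w) := by
  let m : Fin n → Fin l := fun a => ⟨a % l, Nat.mod_lt _ hl⟩
  have h : SimpleGraph.turanGraph n l = (⊤ : SimpleGraph (Fin l)).comap m := by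
    ext a b
    simp [SimpleGraph.turanGraph_adj, m]
  rw [h]
  symm
  refine strongHomWeight_comap F ⊤ m _ _ fun i => ?_
  rw [Finset.sum_const, nsmul_eq_mul]
  congr 2
  rw [← card_filter_fin_mod n i.2]
  congr 1
  ext a
  simp [m, Fin.ext_iff]

theorem tendsto_balanced_part_density {l : ℕ} (hl : 0 < l) (i : ℕ) :
    Tendsto (fun n : ℕ => ((n / l + if i < n % l then 1 else 0 : ℕ) : ℝ) * (1 / (n : ℝ)))
      atTop (𝓝 (1 / (l : ℝ))) := by
  have hl' : (0 : ℝ) < l := by exact_mod_cast hl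
  have h0 : Tendsto (fun n : ℕ => 1 / (n : ℝ)) atTop (𝓝 0) := tendsto_one_div_atTop_nhds_zero_nat
  have hlow : Tendsto (fun n : ℕ => 1 / (l : ℝ) - 1 / (n : ℝ)) atTop (𝓝 (1 / (l : ℝ))) := by
    simpa using (tendsto_const_nhds (x := 1 / (l : ℝ))).sub h0
  have hupp : Tendsto (fun n : ℕ => 1 / (l : ℝ) + 1 / (n : ℝ)) atTop (𝓝 (1 / (l : ℝ))) := by
    simpa using (tendsto_const_nhds (x := 1 / (l : ℝ))).add h0
  refine tendsto_of_tendsto_of_tendsto_of_le_of_le' hlow hupp ?_ ?_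
  all_goals
    filter_upwards [eventually_ge_atTop 1] with n hn
    have hn' : (0 : ℝ) < n := by exact_mod_cast hn
    have hdm : (l : ℝ) * ((n / l : ℕ) : ℝ) + ((n % l : ℕ) : ℝ) = n := by
      exact_mod_cast Nat.div_add_mod n l
    have hm1 : ((n % l : ℕ) : ℝ) < l := by exact_mod_cast Nat.mod_lt n hl
    have hm0 : (0 : ℝ) ≤ ((n % l : ℕ) : ℝ) := by positivity
    push_cast
    first
    | rw [mul_one_div, le_div_iff₀ hn']
    | rw [mul_one_div, div_le_iff₀ hn']
    have e : (1 : ℝ) / l * n = ((n / l : ℕ) : ℝ) + ((n % l : ℕ) : ℝ) / l := by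
      rw [← hdm]; field_simp
    have e1 : ((n % l : ℕ) : ℝ) / l ≤ 1 := (div_le_one hl').2 hm1.le
    have e2 : 0 ≤ ((n % l : ℕ) : ℝ) / l := by positivity
    have e3 : (1 : ℝ) / n * n = 1 := by field_simp
    first
    | rw [sub_mul, e, e3]; split_ifs <;> linarith
    | rw [add_mul, e, e3]; split_ifs <;> linarith

theorem tendsto_descFactorial_div_pow (s : ℕ) :
    Tendsto (fun n : ℕ => (n.descFactorial s : ℝ) / (n : ℝ) ^ s) atTop (𝓝 1) := by
  refine (Asymptotics.isEquivalent_iff_tendsto_one ?_).1 (isEquivalent_descFactorial s)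
  filter_upwards [eventually_ge_atTop 1] with n hn
  have : (0 : ℝ) < n := by exact_mod_cast hn
  positivity

theorem tendsto_pow_div_choose (s : ℕ) :
    Tendsto (fun n : ℕ => (n : ℝ) ^ s / (n.choose s : ℝ)) atTop (𝓝 (s.factorial : ℝ)) := by
  have h := ((tendsto_descFactorial_div_pow s).inv₀ one_ne_zero).const_mul (s.factorial : ℝ)
  rw [inv_one, mul_one] at h
  refine h.congr fun n => ?_
  have hs : (s.factorial : ℝ) ≠ 0 := by exact_mod_cast s.factorial_ne_zero
  rw [Nat.descFactorial_eq_factorial_mul_choose, inv_div]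
  push_cast
  rw [← mul_div_assoc, mul_div_mul_left _ _ hs]

theorem inducedDensity_eq (F : SimpleGraph α) {n : ℕ} (G : SimpleGraph (Fin n)) :
    inducedDensity F G = (Nat.card (F ↪g G) : ℝ) / (Nat.card (F ≃g F)) /
      (n.choose (Fintype.card α)) := by
  have hfin : Finite (F ≃g F) := Finite.of_injective _ DFunLike.coe_injective
  have hne : Nonempty (F ≃g F) := ⟨RelIso.refl _⟩
  have : (Nat.card (F ≃g F) : ℝ) ≠ 0 := by exact_mod_cast Nat.card_pos.ne'
  rw [card_embedding_eq_inducedCount_mul, inducedDensity, Fintype.card_fin]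
  push_cast
  rw [mul_div_cancel_right₀ _ this]

end Assembly

/-- Inducibility of the Turán graph `T(s,r)` (`2 ≤ r < s ≤ 3r+1`, `s = pr+q`) over
`K_k`-free graphs for `k > r`: with `t` the largest integer `ℓ ≥ r+1` with
`(ℓ/(ℓ-r))(1-1/ℓ)^s > 1` (and `t = r` if no such `ℓ` exists) and `ℓ = min(k-1,t)`,
it equals `ℓ!·s!/((ℓ-r)!·(r-q)!·q!·(p!)^r·(p+1)^q·ℓ^s)`. -/
theorem stmt10 {r s p q k t : ℕ} (hr : 2 ≤ r) (hrs : r < s) (hs3 : s ≤ 3 * r + 1)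
    (hspq : s = p * r + q) (hq : q < r) (hk : r < k)
    (ht : (r + 1 ≤ t ∧ 1 < turanRatio r s t ∧
            ∀ ℓ : ℕ, r + 1 ≤ ℓ → 1 < turanRatio r s ℓ → ℓ ≤ t) ∨
          (t = r ∧ ∀ ℓ : ℕ, r + 1 ≤ ℓ → ¬ 1 < turanRatio r s ℓ)) :
    ik (SimpleGraph.turanGraph s r) k = gTuran r s p q (min (k - 1) t) := by
  classical
  set l := min (k - 1) t with hl
  have hrl : r ≤ l := le_min (by omega) (by rcases ht with h | h <;> omega)
  have hl0 : 0 < l := by omega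
  have hp : 1 ≤ p := by
    by_contra h
    have : p = 0 := by omega
    subst this
    omega
  have hp3 : p ≤ 3 := by
    by_contra h
    have : 4 * r ≤ p * r := Nat.mul_le_mul_right r (by omega)
    omega
  let c : Fin s → Fin r := fun a => ⟨a % r, Nat.mod_lt _ (by omega)⟩
  have hF : ∀ a b, (SimpleGraph.turanGraph s r).Adj a b ↔ c a ≠ c b := fun a b => by
    simp [SimpleGraph.turanGraph_adj, c]
  have hsurj : Function.Surjective c := fun i =>
    ⟨⟨i, i.2.trans hrs⟩, by ext; simp [c, Nat.mod_eq_of_lt i.2]⟩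
  have hdiv : s / r = p := by
    rw [hspq, mul_comm, Nat.mul_add_div (by omega), Nat.div_eq_of_lt hq, add_zero]
  have hfib : ∀ a, (Finset.univ.filter fun b => c b = c a).card = p ∨
      (Finset.univ.filter fun b => c b = c a).card = p + 1 := by
    intro a
    have h := card_filter_fin_mod s (c a).2
    rw [hdiv] at h
    have e : (Finset.univ.filter fun b => c b = c a) =
        Finset.univ.filter fun b : Fin s => (b : ℕ) % r = c a := by
      ext b
      simp [c]
    rw [e, h]
    split_ifs <;> simp
  set F := SimpleGraph.turanGraph s r with hFdef
  set A : ℝ := (Nat.card (F ≃g F) : ℝ) with hA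
  set D : ℝ := (l.descFactorial r : ℝ) / (l : ℝ) ^ s with hD
  have hA0 : 0 ≤ A := by positivity
  have hub : ∀ l' : ℕ, 1 ≤ l' → l' < k → (l'.descFactorial (Fintype.card (Fin r)) : ℝ) /
      (l' : ℝ) ^ Fintype.card (Fin s) ≤ D := by
    intro l' _ h2
    rw [Fintype.card_fin, Fintype.card_fin]
    exact descFactorial_div_pow_le (by omega) (by omega) ht (by omega)
  have hupper : ∀ n : ℕ, 1 ≤ n → ∀ G : SimpleGraph (Fin n), G.CliqueFree k →
      inducedDensity F G ≤ D * ((n : ℝ) ^ s / (n.choose s : ℝ)) / A := by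
    intro n hn G hG
    have hn' : (0 : ℝ) < n := by exact_mod_cast hn
    have h1 : (Nat.card (F ↪g G) : ℝ) ≤ D * (n : ℝ) ^ s := by
      refine (card_embedding_le_strongHomWeight F G hn).trans ?_
      rw [Fintype.card_fin]
      refine mul_le_mul_of_nonneg_right ?_ (by positivity)
      refine strongHomWeight_le_of_cliqueFree hF hsurj hp hp3 (by convert hfib) hub hG
        ⟨fun _ => by positivity, ?_⟩
      simp [hn'.ne']
    rw [inducedDensity_eq, Fintype.card_fin]
    calc _ ≤ D * (n : ℝ) ^ s / A / (n.choose s : ℝ) := by gcongr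
      _ = _ := by ring
  set L : ℕ → ℝ := fun n => strongHomWeight F (⊤ : SimpleGraph (Fin l))
    (fun i => ((n / l + if (i : ℕ) < n % l then 1 else 0 : ℕ) : ℝ) * (1 / (n : ℝ))) with hL
  have hlower : ∀ n : ℕ, 1 ≤ n → (L n - 1 + (n.descFactorial s : ℝ) / (n : ℝ) ^ s) *
      ((n : ℝ) ^ s / (n.choose s : ℝ)) / A ≤ inducedDensity F (SimpleGraph.turanGraph n l) := by
    intro n hn
    have hn' : (0 : ℝ) < n := by exact_mod_cast hn
    have h2 := strongHomWeight_add_descFactorial_le F (SimpleGraph.turanGraph n l) hn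
    rw [Fintype.card_fin, Fintype.card_fin, strongHomWeight_turanGraph F n hl0] at h2
    have h3 : (L n - 1 + (n.descFactorial s : ℝ) / (n : ℝ) ^ s) * (n : ℝ) ^ s ≤
        (Nat.card (F ↪g SimpleGraph.turanGraph n l) : ℝ) := by
      rw [add_mul, div_mul_cancel₀ _ (by positivity)]
      linarith
    rw [inducedDensity_eq, Fintype.card_fin]
    calc _ = (L n - 1 + (n.descFactorial s : ℝ) / (n : ℝ) ^ s) * (n : ℝ) ^ s / A /
          (n.choose s : ℝ) := by ring
      _ ≤ _ := by gcongr
  have hlim : D * (s.factorial : ℝ) / A = gTuran r s p q l := by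
    rw [hA, hFdef, card_turanGraph_aut (by omega) hrs.le hspq hq, hD, gTuran]
    have hdf : (l.factorial : ℝ) = ((l - r).factorial : ℝ) * (l.descFactorial r : ℝ) := by
      exact_mod_cast (Nat.factorial_mul_descFactorial hrl).symm
    have h1 : ((l - r).factorial : ℝ) ≠ 0 := by exact_mod_cast Nat.factorial_ne_zero _
    have h2 : ((r - q).factorial : ℝ) ≠ 0 := by exact_mod_cast Nat.factorial_ne_zero _
    have h3 : (q.factorial : ℝ) ≠ 0 := by exact_mod_cast Nat.factorial_ne_zero _
    have h4 : (p.factorial : ℝ) ≠ 0 := by exact_mod_cast Nat.factorial_ne_zero _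
    have h5 : (l : ℝ) ≠ 0 := by exact_mod_cast hl0.ne'
    have h6 : (p : ℝ) + 1 ≠ 0 := by positivity
    push_cast
    rw [hdf]
    field_simp
  have hLlim : Tendsto L atTop (𝓝 D) := by
    have h1 : strongHomWeight F (⊤ : SimpleGraph (Fin l)) (fun _ => 1 / (l : ℝ)) = D := by
      rw [strongHomWeight_top_const hF hsurj]
      simp only [Fintype.card_fin]
      rw [one_div, inv_pow, ← div_eq_mul_inv]
    rw [← h1]
    exact ((continuous_strongHomWeight F _).tendsto _).comp
      (tendsto_pi_nhds.2 fun i => tendsto_balanced_part_density hl0 i)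
  refine Tendsto.limUnder_eq ?_
  rw [← hlim]
  have lim1 : Tendsto (fun n : ℕ => (L n - 1 + (n.descFactorial s : ℝ) / (n : ℝ) ^ s) *
      ((n : ℝ) ^ s / (n.choose s : ℝ)) / A) atTop (𝓝 (D * (s.factorial : ℝ) / A)) := by
    have := (((hLlim.sub_const 1).add (tendsto_descFactorial_div_pow s)).mul
      (tendsto_pow_div_choose s)).div_const A
    simpa using this
  have lim2 : Tendsto (fun n : ℕ => D * ((n : ℝ) ^ s / (n.choose s : ℝ)) / A) atTop
      (𝓝 (D * (s.factorial : ℝ) / A)) :=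
    ((tendsto_pow_div_choose s).const_mul D).div_const A
  have hfree : ∀ n, (SimpleGraph.turanGraph n l).CliqueFree k := fun n =>
    (SimpleGraph.turanGraph_cliqueFree hl0).mono (by omega)
  refine tendsto_of_tendsto_of_tendsto_of_le_of_le' lim1 lim2 ?_ ?_
  · filter_upwards [eventually_ge_atTop 1] with n hn
    refine (hlower n hn).trans (le_csSup
      ⟨D * ((n : ℝ) ^ s / (n.choose s : ℝ)) / A, ?_⟩ ⟨_, hfree n, rfl⟩)
    rintro x ⟨G, hG, rfl⟩
    exact hupper n hn G hG
  · filter_upwards [eventually_ge_atTop 1] with n hn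
    refine csSup_le ⟨_, _, hfree n, rfl⟩ ?_
    rintro x ⟨G, hG, rfl⟩
    exact hupper n hn G hG
end

section
/- Let 2 ≤ r ≤ s be integers and write s = pr + q with 0 ≤ q < r. Then the inducibility of the Turán graph T(s,r) over K_{r+1}-free graphs is i_{r+1}(T(s,r)) = r!·s! / ((r−q)!·q!·(p!)^r·(p+1)^q·r^s); in particular it is attained in the limit by balanced complete r-partite graphs. -/
open Filter Topology

section TuranInducibility

open Finset
open scoped Classical

/-- AM-GM for `k` copies of `y` and one copy of `z`. -/
lemma pow_mul_le_mean_pow {y z : ℝ} (hy : 0 ≤ y) (hz : 0 ≤ z) (k : ℕ) :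
    y ^ k * z ≤ ((k * y + z) / (k + 1)) ^ (k + 1) := by
  have hk : (0 : ℝ) < k + 1 := by positivity
  have h := Real.geom_mean_le_arith_mean2_weighted (w₁ := k / (k + 1)) (w₂ := 1 / (k + 1))
    (by positivity) (by positivity) hy hz (by field_simp)
  have h2 := pow_le_pow_left₀ (by positivity) h (k + 1)
  have e1 : (y ^ ((k : ℝ) / (k + 1)) * z ^ ((1 : ℝ) / (k + 1))) ^ (k + 1) = y ^ k * z := by
    rw [mul_pow, ← Real.rpow_natCast, ← Real.rpow_natCast, ← Real.rpow_mul hy,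
      ← Real.rpow_mul hz]
    push_cast
    rw [div_mul_cancel₀ _ hk.ne', div_mul_cancel₀ _ hk.ne', Real.rpow_natCast, Real.rpow_one]
  rw [e1] at h2
  refine h2.trans_eq ?_
  congr 1
  field_simp

/-- Maclaurin's inequality comparing an elementary symmetric function with the mean. -/
lemma sum_prod_powersetCard_le {ι : Type*} (s : Finset ι) (a : ι → ℝ)
    (ha : ∀ i ∈ s, 0 ≤ a i) (q : ℕ) :
    ∑ Q ∈ s.powersetCard q, ∏ i ∈ Q, a i ≤ s.card.choose q * ((∑ i ∈ s, a i) / s.card) ^ q := by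
  induction s using Finset.induction_on generalizing q with
  | empty =>
    cases q with
    | zero => simp
    | succ q => rw [powersetCard_eq_empty.2 (by simp)]; simp
  | insert x s hx ih =>
    cases q with
    | zero => simp
    | succ q =>
      have hx0 : 0 ≤ a x := ha x (by simp)
      have hs0 : ∀ i ∈ s, 0 ≤ a i := fun i hi => ha i (by simp [hi])
      have ih' := ih hs0
      have hdisj : Disjoint (powersetCard (q + 1) s) ((powersetCard q s).image (insert x)) := by
        rw [Finset.disjoint_left]
        intro Q hQ hQ'
        obtain ⟨R, hR, rfl⟩ := mem_image.1 hQ'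
        exact hx ((mem_powersetCard.1 hQ).1 (mem_insert_self x R))
      have hmem : ∀ R ∈ powersetCard q s, x ∉ R := fun R hR hxR =>
        hx ((mem_powersetCard.1 hR).1 hxR)
      rw [powersetCard_succ_insert hx, sum_union hdisj, sum_image, card_insert_of_notMem hx,
        sum_insert hx]
      swap
      · intro R hR R' hR' h
        rw [← erase_insert (hmem R hR), h, erase_insert (hmem R' hR')]
      rw [sum_congr rfl fun R hR => prod_insert (hmem R hR), ← mul_sum]
      set m := s.card with hm
      set y := (∑ i ∈ s, a i) / m with hy
      have hy0 : 0 ≤ y := div_nonneg (sum_nonneg hs0) (by positivity)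
      have hmy : ∑ i ∈ s, a i = m * y := by
        rcases Nat.eq_zero_or_pos m with h | h
        · have : s = ∅ := by rwa [← Finset.card_eq_zero]
          simp [this, h]
        · rw [hy]; field_simp
      rw [hmy]
      clear_value y
      clear hy hmy
      have hstep : ∑ Q ∈ powersetCard (q + 1) s, ∏ i ∈ Q, a i
          + a x * ∑ R ∈ powersetCard q s, ∏ i ∈ R, a i
          ≤ m.choose (q + 1) * y ^ (q + 1) + a x * (m.choose q * y ^ q) :=
        add_le_add (ih' _) (mul_le_mul_of_nonneg_left (ih' _) hx0)
      refine hstep.trans ?_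
      clear_value m
      clear hm hstep ih ih'
      rcases Nat.lt_or_ge m q with hlt | hle
      · rw [Nat.choose_eq_zero_of_lt hlt, Nat.choose_eq_zero_of_lt (by omega : m < q + 1)]
        simp only [Nat.cast_zero, zero_mul, mul_zero, add_zero]
        have : 0 ≤ (m : ℝ) * y := by positivity
        positivity
      · have hmq : (0 : ℝ) ≤ (m : ℝ) - q := by
          rw [sub_nonneg]; exact_mod_cast hle
        have hz0 : 0 ≤ ((m - q) * y + (q + 1) * a x) / (m + 1 : ℝ) := by positivity
        have key := pow_mul_le_mean_pow hy0 hz0 q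
        have c1 : (m.choose q : ℝ) = (m + 1).choose (q + 1) * (q + 1) / (m + 1) := by
          rw [eq_div_iff (by positivity)]
          have := Nat.add_one_mul_choose_eq m q
          rw [mul_comm]
          exact_mod_cast this
        have c2 : (m.choose (q + 1) : ℝ) = (m + 1).choose (q + 1) * (m - q) / (m + 1) := by
          have : ((m + 1).choose (q + 1) : ℝ) = m.choose q + m.choose (q + 1) := by
            exact_mod_cast Nat.choose_succ_succ m q
          have h3 : (m.choose (q + 1) : ℝ) = (m + 1).choose (q + 1) - m.choose q := by
            rw [this]; ring
          rw [h3, c1]; field_simp; ring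
        rw [c1, c2]
        calc _ = ((m + 1).choose (q + 1) : ℝ) *
              (y ^ q * (((m - q) * y + (q + 1) * a x) / (m + 1 : ℝ))) := by
              field_simp; ring
          _ ≤ ((m + 1).choose (q + 1) : ℝ) * _ := mul_le_mul_of_nonneg_left key (by positivity)
          _ = _ := by
              congr 2
              push_cast
              field_simp
              ring

lemma prod_le_mean_pow {ι : Type*} (s : Finset ι) (a : ι → ℝ) (ha : ∀ i ∈ s, 0 ≤ a i) :
    ∏ i ∈ s, a i ≤ ((∑ i ∈ s, a i) / s.card) ^ s.card := by
  simpa using sum_prod_powersetCard_le s a ha s.card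

/-- The `r`-cliques of `G` inside `A`. -/
noncomputable def cliquesIn {β : Type*} (G : SimpleGraph β) (A : Finset β) (r : ℕ) :
    Finset (Finset β) :=
  {K ∈ A.powersetCard r | G.IsClique (K : Set β)}

lemma mem_cliquesIn {β : Type*} {G : SimpleGraph β} {A K : Finset β} {r : ℕ} :
    K ∈ cliquesIn G A r ↔ (K ⊆ A ∧ K.card = r) ∧ G.IsClique (K : Set β) := by
  rw [cliquesIn, mem_filter, mem_powersetCard]

/-- Zykov's bound on the number of `r`-cliques in a graph without `(r + 1)`-cliques. -/
lemma card_cliques_le {β : Type*} (G : SimpleGraph β) (r : ℕ) (A : Finset β)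
    (hA : ∀ K ⊆ A, K.card = r + 1 → ¬ G.IsClique (K : Set β)) :
    (#(cliquesIn G A r) : ℝ) ≤ ((A.card : ℝ) / r) ^ r := by
  induction r generalizing A with
  | zero => simpa [cliquesIn] using
      card_filter_le (A.powersetCard 0) fun K => G.IsClique (K : Set β)
  | succ r ih =>
    rcases A.eq_empty_or_nonempty with rfl | hne
    · simp [cliquesIn]
    let N : β → Finset β := fun v => {w ∈ A | G.Adj v w}
    obtain ⟨v, hvA, hv⟩ := A.exists_max_image (fun v => #(N v)) hne
    have hN : ∀ u ∈ A, ∀ K ⊆ N u, K.card = r + 1 → ¬ G.IsClique (K : Set β) := by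
      intro u hu K hK hKc hcl
      have huK : u ∉ K := fun h => by simpa [N] using hK h
      refine hA (insert u K) ?_ (by rw [card_insert_of_notMem huK, hKc]) ?_
      · exact insert_subset hu (hK.trans (filter_subset _ _))
      · rw [coe_insert]
        exact hcl.insert fun b hb _ => (mem_filter.1 (hK hb)).2
    have hcover : cliquesIn G A (r + 1) ⊆
        (A \ N v).biUnion fun u =>
          (cliquesIn G (N u) r).image (insert u) := by
      intro K hK
      obtain ⟨⟨hKA, hKc⟩, hcl⟩ := mem_cliquesIn.1 hK
      have : ¬ K ⊆ N v := fun h => hN v hvA K h hKc hcl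
      obtain ⟨u, huK, huN⟩ := not_subset.1 this
      refine mem_biUnion.2 ⟨u, mem_sdiff.2 ⟨hKA huK, huN⟩, mem_image.2 ⟨K.erase u, ?_,
        insert_erase huK⟩⟩
      refine mem_cliquesIn.2 ⟨⟨fun w hw => ?_, ?_⟩, ?_⟩
      · have hw' := mem_erase.1 hw
        exact mem_filter.2 ⟨hKA hw'.2, hcl huK hw'.2 (Ne.symm hw'.1)⟩
      · rw [card_erase_of_mem huK, hKc]; rfl
      · exact hcl.subset (by simp)
    have hcard : (#(cliquesIn G A (r + 1)) : ℝ) ≤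
        ∑ u ∈ A \ N v, ((#(N v) : ℝ) / r) ^ r := by
      calc _ ≤ (∑ u ∈ A \ N v, #(cliquesIn G (N u) r) : ℝ) := by
            exact_mod_cast (card_le_card hcover).trans (card_biUnion_le.trans
              (sum_le_sum fun u _ => card_image_le))
        _ ≤ _ := by
            refine sum_le_sum fun u hu => ?_
            have huA := (mem_sdiff.1 hu).1
            refine (ih (N u) (hN u huA)).trans ?_
            have hvu : (#(N u) : ℝ) ≤ #(N v) := by exact_mod_cast hv u huA
            exact pow_le_pow_left₀ (by positivity) (div_le_div_of_nonneg_right hvu (by positivity)) r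
    refine hcard.trans ?_
    rw [sum_const, nsmul_eq_mul, mul_comm, cast_card_sdiff (filter_subset _ _)]
    have hle : (#(N v) : ℝ) ≤ #A := by exact_mod_cast card_le_card (filter_subset _ _)
    refine (pow_mul_le_mean_pow (by positivity) (sub_nonneg.2 hle) r).trans ?_
    push_cast
    have hd : (r : ℝ) * (#(N v) / r) ≤ #(N v) := by
      rcases Nat.eq_zero_or_pos r with h | h
      · simp [h]
      · rw [mul_div_cancel₀ _ (by positivity)]
    refine pow_le_pow_left₀ ?_ ?_ _
    · have := sub_nonneg.2 hle
      positivity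
    · gcongr
      linarith

section Transversal

variable {ι β : Type*} [Fintype ι]

/-- The subsets of `⋃ i, A i` meeting `A i` in exactly `k i` points. -/
noncomputable def profileFamily (A : ι → Finset β) (k : ι → ℕ) : Finset (Finset β) :=
  {S ∈ (univ.biUnion A).powerset | ∀ i, #(S ∩ A i) = k i}

lemma mem_profileFamily {A : ι → Finset β} {k : ι → ℕ} {S : Finset β} :
    S ∈ profileFamily A k ↔ S ⊆ univ.biUnion A ∧ ∀ i, #(S ∩ A i) = k i := by
  rw [profileFamily, mem_filter, mem_powerset]

lemma biUnion_inter_of_disjoint {A : ι → Finset β} (hA : Pairwise fun i j => Disjoint (A i) (A j))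
    {f : ι → Finset β} (hf : ∀ i, f i ⊆ A i) (i : ι) : univ.biUnion f ∩ A i = f i := by
  ext x
  simp only [mem_inter, mem_biUnion, mem_univ, true_and]
  constructor
  · rintro ⟨⟨j, hj⟩, hi⟩
    by_cases hij : j = i
    · rwa [← hij]
    · exact absurd hi (disjoint_left.1 (hA hij) (hf j hj))
  · exact fun h => ⟨⟨i, h⟩, hf i h⟩

lemma card_profileFamily {A : ι → Finset β} (hA : Pairwise fun i j => Disjoint (A i) (A j))
    (k : ι → ℕ) : #(profileFamily A k) = ∏ i, (#(A i)).choose (k i) := by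
  have : #(profileFamily A k) = #(Fintype.piFinset fun i => (A i).powersetCard (k i)) := by
    refine card_bij' (fun S _ i => S ∩ A i) (fun f _ => univ.biUnion f) ?_ ?_ ?_ ?_
    · intro S hS
      exact Fintype.mem_piFinset.2 fun i =>
        mem_powersetCard.2 ⟨inter_subset_right, (mem_profileFamily.1 hS).2 i⟩
    · intro f hf
      have hf' := fun i => mem_powersetCard.1 (Fintype.mem_piFinset.1 hf i)
      refine mem_profileFamily.2 ⟨biUnion_mono fun i _ => (hf' i).1, fun i => ?_⟩
      rw [biUnion_inter_of_disjoint hA fun i => (hf' i).1]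
      exact (hf' i).2
    · intro S hS
      rw [← inter_biUnion]
      exact inter_eq_left.2 (mem_profileFamily.1 hS).1
    · intro f hf
      funext i
      exact biUnion_inter_of_disjoint hA
        (fun i => (mem_powersetCard.1 (Fintype.mem_piFinset.1 hf i)).1) i
  rw [this, Fintype.card_piFinset]
  simp

/-- The size profile taking the value `p + 1` on `Q` and `p` elsewhere. -/
noncomputable def balancedProfile (p : ℕ) (Q : Finset ι) (i : ι) : ℕ :=
  p + if i ∈ Q then 1 else 0

/-- The subsets of `⋃ i, A i` meeting `q` of the sets `A i` in `p + 1` points and the other ones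
in `p` points. -/
noncomputable def balancedFamily (A : ι → Finset β) (p q : ℕ) : Finset (Finset β) :=
  ((univ : Finset ι).powersetCard q).biUnion fun Q => profileFamily A (balancedProfile p Q)

lemma mem_balancedFamily {A : ι → Finset β} {p q : ℕ} {S : Finset β} :
    S ∈ balancedFamily A p q ↔ S ⊆ univ.biUnion A ∧
      ∃ Q : Finset ι, #Q = q ∧ ∀ i, #(S ∩ A i) = balancedProfile p Q i := by
  simp only [balancedFamily, mem_biUnion, mem_powersetCard_univ, mem_profileFamily]
  grind

lemma balancedProfile_injective {κ : Type*} (p : ℕ) :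
    Function.Injective (balancedProfile p : Finset κ → κ → ℕ) := by
  intro Q R h
  ext i
  have := congrFun h i
  unfold balancedProfile at this
  grind

lemma card_balancedFamily {A : ι → Finset β} (hA : Pairwise fun i j => Disjoint (A i) (A j))
    (p q : ℕ) : #(balancedFamily A p q) =
      ∑ Q ∈ (univ : Finset ι).powersetCard q, ∏ i, (#(A i)).choose (balancedProfile p Q i) := by
  rw [balancedFamily, card_biUnion, sum_congr rfl fun Q _ => card_profileFamily hA _]
  intro Q _ R _ hQR
  refine disjoint_left.2 fun S hS hS' => ?_
  refine hQR (balancedProfile_injective p (funext fun i => ?_))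
  rw [← (mem_profileFamily.1 hS).2, (mem_profileFamily.1 hS').2]

/-- A product over a balanced profile splits according to the two values. -/
lemma prod_balancedProfile {M : Type*} [CommMonoid M] (f : ℕ → M) (p : ℕ) (Q : Finset ι) :
    ∏ i, f (balancedProfile p Q i) = f (p + 1) ^ #Q * f p ^ (Fintype.card ι - #Q) := by
  rw [← prod_mul_prod_compl Q, prod_congr rfl (g := fun _ => f (p + 1)),
    prod_congr (s₁ := Qᶜ) rfl (g := fun _ => f p)]
  · simp [card_compl]
  · intro i hi
    simp [balancedProfile, mem_compl.1 hi]
  · intro i hi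
    simp [balancedProfile, hi]

lemma card_balancedFamily_le {A : ι → Finset β}
    (hA : Pairwise fun i j => Disjoint (A i) (A j)) (p q : ℕ) {x : ℝ}
    (hx : ((∑ i, #(A i) : ℕ) : ℝ) / Fintype.card ι ≤ x) :
    (#(balancedFamily A p q) : ℝ) ≤ (Fintype.card ι).choose q *
      x ^ (p * Fintype.card ι + q) /
        ((p + 1).factorial ^ q * p.factorial ^ (Fintype.card ι - q)) := by
  have hx0 : 0 ≤ x := le_trans (by positivity) hx
  rw [card_balancedFamily hA]
  rw [Nat.cast_sum] at hx ⊢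
  simp only [Nat.cast_prod]
  obtain ⟨D, hD⟩ : ∃ D : ℝ, D =
      ((p + 1).factorial : ℝ) ^ q * (p.factorial : ℝ) ^ (Fintype.card ι - q) := ⟨_, rfl⟩
  have hD0 : 0 < D := by rw [hD]; positivity
  rw [← hD]
  have step : ∀ Q ∈ (univ : Finset ι).powersetCard q,
      ∏ i, ((#(A i)).choose (balancedProfile p Q i) : ℝ) ≤
        (∏ i, (#(A i) : ℝ)) ^ p * (∏ i ∈ Q, (#(A i) : ℝ)) / D := by
    intro Q hQ
    have hQ' : #Q = q := (mem_powersetCard.1 hQ).2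
    calc ∏ i, ((#(A i)).choose (balancedProfile p Q i) : ℝ)
        ≤ ∏ i, ((#(A i) : ℝ) ^ balancedProfile p Q i / (balancedProfile p Q i).factorial) :=
          prod_le_prod (fun _ _ => by positivity) fun i _ => Nat.choose_le_pow_div _ _
      _ = (∏ i, (#(A i) : ℝ) ^ balancedProfile p Q i) / D := by
          rw [prod_div_distrib, prod_balancedProfile (fun n => (n.factorial : ℝ)), hQ', hD]
      _ = _ := by
          congr 1
          simp only [balancedProfile, pow_add, prod_mul_distrib, prod_pow, pow_ite, pow_one,
            pow_zero, prod_ite_mem, univ_inter]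
  refine (sum_le_sum step).trans ?_
  rw [← sum_div, ← mul_sum]
  refine div_le_div_of_nonneg_right ?_ hD0.le
  have h1 := prod_le_mean_pow univ (fun i => (#(A i) : ℝ)) fun _ _ => by positivity
  have h2 := sum_prod_powersetCard_le univ (fun i => (#(A i) : ℝ)) (fun _ _ => by positivity) q
  rw [card_univ] at h1 h2
  have h1' := h1.trans (pow_le_pow_left₀ (by positivity) hx _)
  have h2' := h2.trans (mul_le_mul_of_nonneg_left (pow_le_pow_left₀ (by positivity) hx q)
    (by positivity))
  calc _ ≤ (x ^ Fintype.card ι) ^ p * ((Fintype.card ι).choose q * x ^ q) :=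
        mul_le_mul (pow_le_pow_left₀ (by positivity) h1' p) h2' (by positivity) (by positivity)
    _ = _ := by rw [pow_add, mul_comm p, pow_mul]; ring

lemma le_card_balancedFamily {A : ι → Finset β}
    (hA : Pairwise fun i j => Disjoint (A i) (A j)) (p q : ℕ) {m : ℕ} (hm : ∀ i, m ≤ #(A i)) :
    (Fintype.card ι).choose q * (m.choose (p + 1) ^ q * m.choose p ^ (Fintype.card ι - q)) ≤
      #(balancedFamily A p q) := by
  rw [card_balancedFamily hA, ← card_univ (α := ι), ← card_powersetCard, ← smul_eq_mul]
  refine card_nsmul_le_sum _ _ _ fun Q hQ => ?_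
  have hQ' : #Q = q := (mem_powersetCard.1 hQ).2
  rw [card_univ, ← hQ', ← prod_balancedProfile]
  exact prod_le_prod' fun i _ => Nat.choose_le_choose _ (hm i)

end Transversal

section TuranCopies

/-- The part of the Turán graph containing a given vertex. -/
def turanPart {n r : ℕ} (hr : 0 < r) (v : Fin n) : Fin r := ⟨v % r, Nat.mod_lt _ hr⟩

lemma turanGraph_adj_iff_turanPart {n r : ℕ} (hr : 0 < r) (v w : Fin n) :
    (SimpleGraph.turanGraph n r).Adj v w ↔ turanPart hr v ≠ turanPart hr w := by
  simp [SimpleGraph.turanGraph_adj, turanPart]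

lemma card_turanPart {n r : ℕ} (hr : 0 < r) (i : Fin r) :
    #{v : Fin n | turanPart hr v = i} = n / r + if (i : ℕ) < n % r then 1 else 0 := by
  have h := Nat.count_modEq_card n hr i
  rw [Nat.mod_eq_of_lt i.2] at h
  rw [← h, Nat.count_eq_card_filter_range]
  have hiff : ∀ v : Fin n, turanPart hr v = i ↔ v ≡ i [MOD r] := fun v => by
    simp [turanPart, Fin.ext_iff, Nat.ModEq, Nat.mod_eq_of_lt i.2]
  refine card_bij (fun v _ => v) (fun v hv => ?_) (fun v _ w _ h => Fin.ext h) fun v hv => ?_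
  · exact mem_filter.2 ⟨mem_range.2 v.2, (hiff v).1 (mem_filter.1 hv).2⟩
  · obtain ⟨hv, hvi⟩ := mem_filter.1 hv
    exact ⟨⟨v, mem_range.1 hv⟩, mem_filter.2 ⟨mem_univ _, (hiff _).2 hvi⟩, rfl⟩

/-- A vertex set induces a Turán graph exactly when it is complete multipartite with parts of
the right sizes. -/
lemma induces_turanGraph_iff {r s p q : ℕ} (hspq : s = p * r + q) (hq : q < r) {β : Type*}
    (G : SimpleGraph β) (S : Finset β) :
    (#S = s ∧ Nonempty (SimpleGraph.turanGraph s r ≃g G.induce (S : Set β))) ↔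
      ∃ c : β → Fin r, (∀ v ∈ S, ∀ w ∈ S, G.Adj v w ↔ c v ≠ c w) ∧
        ∃ Q : Finset (Fin r), #Q = q ∧ ∀ i, #{v ∈ S | c v = i} = balancedProfile p Q i := by
  have hr : 0 < r := by omega
  have hdiv : s / r = p := by
    rw [hspq, mul_comm, Nat.mul_add_div hr, Nat.div_eq_of_lt hq, add_zero]
  have hmod : s % r = q := by
    rw [hspq, mul_comm, Nat.mul_add_mod, Nat.mod_eq_of_lt hq]
  let P : Finset (Fin r) := {i | (i : ℕ) < q}
  have hP : #P = q := by
    simp only [P]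
    rw [Fin.card_filter_val_lt]
    omega
  have hfib : ∀ i : Fin r, #{x : Fin s | turanPart hr x = i} = balancedProfile p P i := by
    intro i
    rw [card_turanPart, hdiv, hmod]
    simp [balancedProfile, P]
  constructor
  · rintro ⟨-, ⟨e⟩⟩
    let c : β → Fin r := fun v => if h : v ∈ S then turanPart hr (e.symm ⟨v, h⟩) else ⟨0, hr⟩
    have hc : ∀ v (h : v ∈ S), c v = turanPart hr (e.symm ⟨v, h⟩) := fun v h => dif_pos h
    refine ⟨c, fun v hv w hw => ?_, P, hP, fun i => ?_⟩
    · rw [hc v hv, hc w hw, ← turanGraph_adj_iff_turanPart, e.symm.map_adj_iff]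
      rfl
    · rw [← hfib]
      refine card_bij' (fun v hv => e.symm ⟨v, (mem_filter.1 hv).1⟩) (fun x _ => (e x : β))
        ?_ ?_ ?_ ?_
      · intro v hv
        obtain ⟨hvS, hvi⟩ := mem_filter.1 hv
        rw [hc v hvS] at hvi
        simpa using hvi
      · intro x hx
        have hxS : (e x : β) ∈ S := (e x).2
        refine mem_filter.2 ⟨hxS, ?_⟩
        rw [hc _ hxS]
        simpa using hx
      · intro v hv
        simp
      · intro x hx
        simp
  · rintro ⟨c, hadj, Q, hQ, hcard⟩
    obtain ⟨σ, hσ⟩ : ∃ σ : Equiv.Perm (Fin r), ∀ i, σ i ∈ Q ↔ i ∈ P := by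
      have e : {x // x ∈ P} ≃ {x // x ∈ Q} := Fintype.equivOfCardEq (by simp [hP, hQ])
      exact ⟨e.extendSubtype, fun i => ⟨fun h => by_contra fun hi =>
        e.extendSubtype_not_mem i hi h, fun h => e.extendSubtype_mem i h⟩⟩
    have hequiv : ∀ i, Nonempty ({x : Fin s // σ (turanPart hr x) = i} ≃
        {v : (S : Set β) // c v = i}) := by
      intro i
      refine Fintype.card_eq.1 ?_
      have h1 : Fintype.card {x : Fin s // σ (turanPart hr x) = i} =
          balancedProfile p P (σ.symm i) := by
        rw [← hfib, Fintype.card_subtype]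
        congr 1
        ext x
        simp [Equiv.eq_symm_apply]
      have h2 : Fintype.card {v : (S : Set β) // c v = i} = balancedProfile p Q i := by
        rw [← hcard, Fintype.card_subtype]
        refine card_bij (fun v _ => (v : β)) ?_ ?_ ?_
        · intro v hv
          exact mem_filter.2 ⟨v.2, by simpa using hv⟩
        · intro v _ w _ h
          exact Subtype.ext h
        · intro v hv
          obtain ⟨hvS, hvi⟩ := mem_filter.1 hv
          exact ⟨⟨v, hvS⟩, by simpa using hvi, rfl⟩
      rw [h1, h2]
      simp [balancedProfile, ← hσ]
    let e : Fin s ≃ (S : Set β) := Equiv.ofFiberEquiv fun i => (hequiv i).some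
    have he : ∀ x, c (e x) = σ (turanPart hr x) := fun x =>
      Equiv.ofFiberEquiv_map (f := fun x : Fin s => σ (turanPart hr x))
        (g := fun v : (S : Set β) => c v) (fun i => (hequiv i).some) x
    refine ⟨by simpa using (Fintype.card_congr e).symm, ⟨⟨e, fun {x y} => ?_⟩⟩⟩
    rw [turanGraph_adj_iff_turanPart hr]
    change G.Adj (e x) (e y) ↔ _
    rw [hadj _ (e x).2 _ (e y).2, he, he, Ne, σ.injective.eq_iff]

variable {r s p q : ℕ} {β : Type*} [Fintype β]

/-- The vertex sets of the induced copies of the Turán graph `T(s, r)` in `G`. -/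
noncomputable def turanCopies (s r : ℕ) (G : SimpleGraph β) : Finset (Finset β) :=
  {S | #S = s ∧ Nonempty (SimpleGraph.turanGraph s r ≃g G.induce (S : Set β))}

lemma mem_turanCopies {G : SimpleGraph β} {S : Finset β} : S ∈ turanCopies s r G ↔
    #S = s ∧ Nonempty (SimpleGraph.turanGraph s r ≃g G.induce (S : Set β)) := by
  simp [turanCopies]

lemma inducedCount_turanGraph (G : SimpleGraph β) :
    inducedCount (SimpleGraph.turanGraph s r) G = #(turanCopies s r G) := by
  rw [inducedCount, ← Set.ncard_coe_finset]
  congr 1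
  ext S
  simp [mem_turanCopies]

/-- A copy of the Turán graph contains at least as many `r`-cliques as it has transversals. -/
lemma le_card_cliquesIn (hspq : s = p * r + q) (hq : q < r) {G : SimpleGraph β} {S : Finset β}
    (hS : S ∈ turanCopies s r G) :
    (p + 1) ^ q * p ^ (r - q) ≤ #(cliquesIn G S r) := by
  obtain ⟨c, hadj, Q, hQ, hcard⟩ := (induces_turanGraph_iff hspq hq G S).1 (mem_turanCopies.1 hS)
  have h : #(Fintype.piFinset fun i : Fin r => {v ∈ S | c v = i}) = (p + 1) ^ q * p ^ (r - q) := by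
    rw [Fintype.card_piFinset, prod_congr rfl fun i _ => hcard i,
      prod_balancedProfile (fun n => n), hQ, Fintype.card_fin]
  rw [← h]
  have hmem : ∀ f ∈ (Fintype.piFinset fun i : Fin r => {v ∈ S | c v = i}),
      ∀ i, f i ∈ S ∧ c (f i) = i := fun f hf i => mem_filter.1 (Fintype.mem_piFinset.1 hf i)
  refine card_le_card_of_injOn (fun f => univ.image f) ?_ ?_
  · intro f hf
    have hf := hmem f hf
    have hinj : Function.Injective f := fun i j h => by rw [← (hf i).2, h, (hf j).2]
    refine mem_cliquesIn.2 ⟨⟨?_, by simp [card_image_of_injective _ hinj]⟩, ?_⟩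
    · intro v hv
      obtain ⟨i, -, rfl⟩ := mem_image.1 hv
      exact (hf i).1
    · intro v hv w hw hvw
      obtain ⟨i, -, rfl⟩ := mem_image.1 (mem_coe.1 hv)
      obtain ⟨j, -, rfl⟩ := mem_image.1 (mem_coe.1 hw)
      rw [hadj _ (hf i).1 _ (hf j).1, (hf i).2, (hf j).2]
      exact fun h => hvw (congrArg f h)
  · intro f hf g hg hfg
    have hf := hmem f hf
    have hg := hmem g hg
    funext i
    have : f i ∈ univ.image g := by
      rw [← show univ.image f = univ.image g from hfg]
      exact mem_image_of_mem _ (mem_univ i)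
    obtain ⟨j, -, hj⟩ := mem_image.1 this
    have hij : j = i := by rw [← (hg j).2, hj, (hf i).2]
    rw [← hj, hij]

/-- The vertices other than `v` that are adjacent to all of `K` but `v`, and not to `v`. -/
noncomputable def cloneSet (G : SimpleGraph β) (K : Finset β) (v : K) : Finset β :=
  {w | w ≠ v ∧ ¬ G.Adj w v ∧ ∀ u ∈ K, u ≠ v → G.Adj w u}

lemma disjoint_cloneSet (G : SimpleGraph β) (K : Finset β) :
    Pairwise fun u v => Disjoint (cloneSet G K u) (cloneSet G K v) := by
  intro u v huv
  refine disjoint_left.2 fun w hu hv => ?_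
  simp only [cloneSet, mem_filter, mem_univ, true_and] at hu hv
  exact hv.2.1 (hu.2.2 v v.2 fun h => huv (Subtype.ext h.symm))

/-- Removing a fixed clique embeds the copies containing it in a balanced family. -/
lemma card_turanCopies_superset_le (hspq : s = (p + 1) * r + q) (hq : q < r) {G : SimpleGraph β}
    {K : Finset β} (hK : #K = r) (hcl : G.IsClique (K : Set β)) :
    #{S ∈ turanCopies s r G | K ⊆ S} ≤ #(balancedFamily (cloneSet G K) p q) := by
  refine card_le_card_of_injOn (fun S => S \ K) ?_ ?_
  · intro S hS
    obtain ⟨hS, hKS⟩ := mem_filter.1 hS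
    obtain ⟨c, hadj, Q, hQ, hcard⟩ :=
      (induces_turanGraph_iff hspq hq G S).1 (mem_turanCopies.1 hS)
    have hcinj : Function.Injective fun v : K => c v := by
      intro u v huv
      by_contra hne
      exact (hadj u (hKS u.2) v (hKS v.2)).1
        (hcl u.2 v.2 fun h => hne (Subtype.ext h)) huv
    have hcbij : Function.Bijective fun v : K => c v :=
      (Fintype.bijective_iff_injective_and_card _).2 ⟨hcinj, by simp [hK]⟩
    have hclone : ∀ v : K, ∀ w ∈ S \ K, w ∈ cloneSet G K v ↔ c w = c v := by
      intro v w hw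
      obtain ⟨hwS, hwK⟩ := mem_sdiff.1 hw
      simp only [cloneSet, mem_filter, mem_univ, true_and]
      constructor
      · intro h
        by_contra hne
        exact h.2.1 ((hadj w hwS v (hKS v.2)).2 hne)
      · intro h
        refine ⟨fun hwv => hwK (hwv ▸ v.2), fun hwv => ?_, fun u hu huv => ?_⟩
        · exact (hadj w hwS v (hKS v.2)).1 hwv h
        · rw [hadj w hwS u (hKS hu), h]
          exact fun hc => huv (congrArg Subtype.val (hcinj (a₁ := v) (a₂ := ⟨u, hu⟩) hc)).symm
    refine mem_balancedFamily.2 ⟨fun w hw => ?_, ({v | c v ∈ Q} : Finset K), ?_, fun v => ?_⟩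
    · obtain ⟨v, hv⟩ := hcbij.2 (c w)
      exact mem_biUnion.2 ⟨v, mem_univ _, (hclone v w hw).2 hv.symm⟩
    · rw [← hQ]
      refine card_bij (fun v _ => c v) (fun v hv => by simpa using hv)
        (fun u _ v _ h => hcinj h) fun i hi => ?_
      obtain ⟨v, rfl⟩ := hcbij.2 i
      exact ⟨v, by simpa using hi, rfl⟩
    · have hsplit : {w ∈ S | c w = c v} = insert (v : β) ((S \ K) ∩ cloneSet G K v) := by
        ext w
        simp only [mem_filter, mem_insert, mem_inter]
        constructor
        · rintro ⟨hwS, hwc⟩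
          by_cases hwK : w ∈ K
          · exact Or.inl (congrArg Subtype.val (hcinj (a₁ := ⟨w, hwK⟩) (a₂ := v) hwc))
          · have hw : w ∈ S \ K := mem_sdiff.2 ⟨hwS, hwK⟩
            exact Or.inr ⟨hw, (hclone v w hw).2 hwc⟩
        · rintro (rfl | ⟨hw, hwc⟩)
          · exact ⟨hKS v.2, rfl⟩
          · exact ⟨(mem_sdiff.1 hw).1, (hclone v w hw).1 hwc⟩
      have := hcard (c v)
      rw [hsplit, card_insert_of_notMem (by simp)] at this
      simp only [balancedProfile, mem_filter, mem_univ, true_and] at this ⊢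
      by_cases hv : c v ∈ Q
      · simp only [hv, if_true] at this ⊢
        omega
      · simp only [hv, if_false] at this ⊢
        omega
  · intro S hS T hT hST
    have hS := (mem_filter.1 hS).2
    have hT := (mem_filter.1 hT).2
    rw [← sdiff_union_of_subset hS, show S \ K = T \ K from hST, sdiff_union_of_subset hT]

end TuranCopies

section Asymptotics

variable {r s p q : ℕ}

lemma gTuran_mul_pow_div (hq : q < r) (y : ℝ) :
    gTuran r s p q r * (y ^ s / s.factorial) =
      r.choose q * (y / r) ^ s / (p.factorial ^ r * (p + 1) ^ q) := by
  have hr : (r : ℝ) ≠ 0 := by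
    have : 0 < r := by omega
    positivity
  rw [gTuran, Nat.cast_choose ℝ hq.le, div_pow]
  push_cast
  simp only [Nat.sub_self, Nat.factorial_zero, Nat.cast_one, one_mul]
  field_simp

lemma factorial_profile_eq (hq : q < r) :
    (((p + 1).factorial : ℝ)) ^ q * (p.factorial : ℝ) ^ (r - q) =
      p.factorial ^ r * (p + 1) ^ q := by
  rw [Nat.factorial_succ, ← pow_mul_pow_sub (p.factorial : ℝ) hq.le]
  push_cast
  rw [mul_pow]
  ring

lemma card_turanCopies_le {β : Type*} [Fintype β] (hspq : s = p * r + q) (hq : q < r)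
    (hp : 1 ≤ p) {G : SimpleGraph β} (hG : G.CliqueFree (r + 1)) :
    (#(turanCopies s r G) : ℝ) ≤
      gTuran r s p q r * ((Fintype.card β : ℝ) ^ s / s.factorial) := by
  obtain ⟨t, rfl⟩ : ∃ t, p = t + 1 := ⟨p - 1, by omega⟩
  set x : ℝ := (Fintype.card β : ℝ) / r with hx
  have hx0 : 0 ≤ x := by positivity
  have hcount : #(turanCopies s r G) • (((t + 1 + 1) ^ q * (t + 1) ^ (r - q) : ℕ) : ℝ) ≤
      #(cliquesIn G univ r) • (r.choose q * x ^ (t * r + q) /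
        ((t + 1).factorial ^ q * t.factorial ^ (r - q))) := by
    refine card_nsmul_le_card_nsmul (fun S K => K ⊆ S) (fun S hS => ?_) fun K hK => ?_
    · refine Nat.cast_le.2 ((le_card_cliquesIn hspq hq hS).trans (card_le_card fun K hK => ?_))
      obtain ⟨⟨hKS, hKc⟩, hcl⟩ := mem_cliquesIn.1 hK
      exact mem_filter.2 ⟨mem_cliquesIn.2 ⟨⟨subset_univ _, hKc⟩, hcl⟩, hKS⟩
    · obtain ⟨⟨-, hKc⟩, hcl⟩ := mem_cliquesIn.1 hK
      have h1 : (#{S ∈ turanCopies s r G | K ⊆ S} : ℝ) ≤ #(balancedFamily (cloneSet G K) t q) :=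
        Nat.cast_le.2 (card_turanCopies_superset_le hspq hq hKc hcl)
      have hcardK : Fintype.card K = r := by simp [hKc]
      have h2 := card_balancedFamily_le (disjoint_cloneSet G K) t q (x := x) (by
        rw [hcardK, hx]
        refine div_le_div_of_nonneg_right (Nat.cast_le.2 ?_) (by positivity)
        rw [← card_biUnion fun u _ v _ huv => disjoint_cloneSet G K huv]
        exact card_le_univ _)
      rw [hcardK] at h2
      exact h1.trans h2
  have hcl : (#(cliquesIn G univ r) : ℝ) ≤ x ^ r := by
    have := card_cliques_le G r univ fun K _ hK hcl => hG K ⟨hcl, hK⟩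
    rwa [card_univ] at this
  rw [nsmul_eq_mul, nsmul_eq_mul] at hcount
  have hD : (0 : ℝ) < ((t + 1 + 1) ^ q * (t + 1) ^ (r - q) : ℕ) := by positivity
  rw [gTuran_mul_pow_div hq, ← hx]
  have h := hcount.trans (mul_le_mul_of_nonneg_right hcl (by positivity))
  rw [← le_div_iff₀ hD] at h
  refine h.trans_eq ?_
  rw [mul_div_assoc', div_div]
  congr 1
  · rw [hspq]; ring
  · rw [Nat.factorial_succ]
    obtain ⟨d, rfl⟩ : ∃ d, r = q + d := ⟨r - q, by omega⟩
    rw [Nat.add_sub_cancel_left]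
    push_cast
    simp only [mul_pow, pow_add]
    ring

lemma le_card_turanCopies_turanGraph (hspq : s = p * r + q) (hq : q < r) (n : ℕ) :
    r.choose q * ((n / r).choose (p + 1) ^ q * (n / r).choose p ^ (r - q)) ≤
      #(turanCopies s r (SimpleGraph.turanGraph n r)) := by
  have hr : 0 < r := by omega
  let A : Fin r → Finset (Fin n) := fun i => {v | turanPart hr v = i}
  have hA : Pairwise fun i j => Disjoint (A i) (A j) := by
    intro i j hij
    refine disjoint_left.2 fun v hv hv' => hij ?_
    rw [← (mem_filter.1 hv).2, (mem_filter.1 hv').2]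
  have h := le_card_balancedFamily hA p q (m := n / r) fun i => by
    simp only [A, card_turanPart]
    omega
  rw [Fintype.card_fin] at h
  refine h.trans (card_le_card fun S hS => ?_)
  obtain ⟨-, Q, hQ, hcard⟩ := mem_balancedFamily.1 hS
  refine mem_turanCopies.2 ((induces_turanGraph_iff hspq hq _ S).2
    ⟨turanPart hr, fun v _ w _ => turanGraph_adj_iff_turanPart hr v w, Q, hQ, fun i => ?_⟩)
  rw [← hcard]
  congr 1
  ext v
  simp [A]

open Asymptotics

lemma isEquivalent_nat_div (hr : 0 < r) :
    (fun n : ℕ => ((n / r : ℕ) : ℝ)) ~[atTop] fun n : ℕ => (n : ℝ) / r := by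
  have hr' : (0 : ℝ) < r := by positivity
  have h := (isEquivalent_nat_floor (R := ℝ)).comp_tendsto
    (tendsto_natCast_atTop_atTop.atTop_div_const hr')
  refine h.congr_left (Eventually.of_forall fun n => ?_)
  simp [Nat.floor_div_eq_div]

lemma isEquivalent_choose_div (hr : 0 < r) (k : ℕ) :
    (fun n : ℕ => ((n / r).choose k : ℝ)) ~[atTop]
      fun n : ℕ => ((n : ℝ) / r) ^ k / k.factorial := by
  have h1 := (isEquivalent_choose k).comp_tendsto (Nat.tendsto_div_const_atTop hr.ne')
  exact h1.trans (((isEquivalent_nat_div hr).pow k).div IsEquivalent.refl)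

lemma isEquivalent_turan_count (hspq : s = p * r + q) (hq : q < r) :
    (fun n : ℕ => ((r.choose q * ((n / r).choose (p + 1) ^ q * (n / r).choose p ^ (r - q)) : ℕ) : ℝ))
      ~[atTop] fun n : ℕ => gTuran r s p q r * ((n : ℝ) ^ s / s.factorial) := by
  have hr : 0 < r := by omega
  have h := (IsEquivalent.refl (u := fun _ : ℕ => (r.choose q : ℝ)) (l := atTop)).mul
    (((isEquivalent_choose_div hr (p + 1)).pow q).mul ((isEquivalent_choose_div hr p).pow (r - q)))
  refine (h.congr_left (Eventually.of_forall fun n => ?_)).congr_right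
    (Eventually.of_forall fun n => ?_)
  · simp
  · simp only [Pi.mul_apply, Pi.pow_apply]
    rw [gTuran_mul_pow_div hq, ← factorial_profile_eq hq]
    have hs : s = (p + 1) * q + p * (r - q) := by
      obtain ⟨d, rfl⟩ : ∃ d, r = q + d := ⟨r - q, by omega⟩
      rw [hspq, Nat.add_sub_cancel_left]
      ring
    rw [div_pow _ ((p + 1).factorial : ℝ), div_pow _ (p.factorial : ℝ), ← pow_mul, ← pow_mul,
      div_mul_div_comm, ← pow_add, ← hs, mul_div_assoc]

lemma tendsto_div_choose {f : ℕ → ℝ} {g : ℝ}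
    (hf : f ~[atTop] fun n : ℕ => g * ((n : ℝ) ^ s / s.factorial)) :
    Tendsto (fun n : ℕ => f n / (n.choose s : ℝ)) atTop (𝓝 g) := by
  have h := hf.div (isEquivalent_choose s)
  refine h.symm.tendsto_nhds (tendsto_const_nhds.congr' ?_)
  filter_upwards [eventually_gt_atTop 0] with n hn
  have : (n : ℝ) ^ s / s.factorial ≠ 0 := by positivity
  simp only [Pi.div_apply]
  rw [mul_div_cancel_right₀ _ this]

end Asymptotics

end TuranInducibility

/-- For `2 ≤ r ≤ s` with `s = pr + q`, `0 ≤ q < r`, `p ≥ 1`, the inducibility of the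
Turán graph `T(s,r)` over `K_{r+1}`-free graphs is
`r!·s!/((r-q)!·q!·(p!)^r·(p+1)^q·r^s)`. -/
theorem stmt12 {r s p q : ℕ} (hr : 2 ≤ r) (hrs : r ≤ s)
    (hspq : s = p * r + q) (hq : q < r) (hp : 1 ≤ p) :
    ik (SimpleGraph.turanGraph s r) (r + 1) = gTuran r s p q r := by
  have hdensity : ∀ {n : ℕ} (G : SimpleGraph (Fin n)),
      inducedDensity (SimpleGraph.turanGraph s r) G =
        (turanCopies s r G).card / (n.choose s : ℝ) := fun {n} G => by
    rw [inducedDensity, inducedCount_turanGraph, Fintype.card_fin, Fintype.card_fin]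
  have hupper : ∀ n : ℕ, ∀ x ∈ {x : ℝ | ∃ G : SimpleGraph (Fin n), G.CliqueFree (r + 1) ∧
      x = inducedDensity (SimpleGraph.turanGraph s r) G},
      x ≤ gTuran r s p q r * ((n : ℝ) ^ s / s.factorial) / (n.choose s : ℝ) := by
    rintro n x ⟨G, hG, rfl⟩
    rw [hdensity]
    have h := card_turanCopies_le hspq hq hp hG
    rw [Fintype.card_fin] at h
    exact div_le_div_of_nonneg_right h (by positivity)
  have hmem : ∀ n : ℕ, inducedDensity (SimpleGraph.turanGraph s r) (SimpleGraph.turanGraph n r) ∈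
      {x : ℝ | ∃ G : SimpleGraph (Fin n), G.CliqueFree (r + 1) ∧
        x = inducedDensity (SimpleGraph.turanGraph s r) G} := fun n =>
    ⟨_, SimpleGraph.turanGraph_cliqueFree (by omega), rfl⟩
  refine Tendsto.limUnder_eq (tendsto_of_tendsto_of_tendsto_of_le_of_le
    (tendsto_div_choose (isEquivalent_turan_count hspq hq))
    (tendsto_div_choose (s := s) (f := fun n => gTuran r s p q r * ((n : ℝ) ^ s / s.factorial))
      Asymptotics.IsEquivalent.refl) (fun n => ?_) fun n => ?_)
  · refine le_trans ?_ (le_csSup ⟨_, hupper n⟩ (hmem n))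
    rw [hdensity]
    exact div_le_div_of_nonneg_right
      (Nat.cast_le.2 (le_card_turanCopies_turanGraph hspq hq n)) (by positivity)
  · exact csSup_le ⟨_, hmem n⟩ (hupper n)
end
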